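/- arXiv:1405.1672 — 2 statements merged into one kernel-verified Lean document; each statement's English description precedes it below -/
import Mathlib

section
/- Let λ ≥ 1 be an integer, let G be a finite simple graph with minimum degree δ, and let C be a longest cycle in G. If min{λ − 2, δ − λ} ≤ p̄ ≤ max{λ − 2, δ − λ}, where p̄ is the length of a longest path in the subgraph of G induced by the vertices not on C, then |C| ≥ λ(δ − λ + 2). -/
open SimpleGraph

/-- A cycle `C` is a longest cycle in `G` if no cycle of `G` has greater length. -/
def IsLongestCycle {V : Type*} (G : SimpleGraph V) {v : V} (C : G.Walk v v) : Prop :=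
  C.IsCycle ∧ ∀ (u : V) (D : G.Walk u u), D.IsCycle → D.length ≤ C.length

open scoped Classical in
/-- The length of a longest path in `H`, with the convention that it is `-1`
when `H` has no vertices. -/
noncomputable def pbar {W : Type*} (H : SimpleGraph W) : ℤ :=
  if Nonempty W then
    ((sSup {n : ℕ | ∃ (u v : W) (p : H.Walk u v), p.IsPath ∧ p.length = n} : ℕ) : ℤ)
  else -1

/-- The length of a longest cycle in `H`, where a single vertex counts as a cycle of
length 1 and a single edge as a cycle of length 2, with the convention that it is `0`
when `H` has no vertices. -/
noncomputable def cbar {W : Type*} (H : SimpleGraph W) : ℕ :=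
  sSup {n : ℕ | (n = 1 ∧ Nonempty W) ∨ (n = 2 ∧ ∃ u v : W, H.Adj u v) ∨
    ∃ (v : W) (c : H.Walk v v), c.IsCycle ∧ c.length = n}

/-- `G` is `k`-connected: it has at least `k+1` vertices and remains connected
after the deletion of any set of fewer than `k` vertices. -/
def IsKConnected {V : Type*} [Fintype V] (G : SimpleGraph V) (k : ℕ) : Prop :=
  k + 1 ≤ Fintype.card V ∧
    ∀ S : Finset V, S.card < k → (G.induce ((↑S : Set V)ᶜ)).Connected


theorem add_sum_le_of_gaps (I : Finset ℕ) (α β : ℕ → ℤ) (B : ℤ)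
    (hgap : ∀ i ∈ I, ∀ j ∈ I, i < j → β i + α j ≤ (j : ℤ) - i)
    (hstart : ∀ i ∈ I, B + α i ≤ i) :
    ∀ k q : ℤ, B + q ≤ k → (∀ i ∈ I, β i + q ≤ k - i) →
      B + q + ∑ i ∈ I, (α i + β i) ≤ k := by
  induction I using Finset.induction_on_max with
  | empty => intro k q h _; simpa using h
  | insert m I hm ih =>
    intro k q _ hk
    have hmI : m ∉ I := fun h => lt_irrefl _ (hm m h)
    have h1 := ih
      (fun i hi j hj => hgap i (Finset.mem_insert_of_mem hi) j (Finset.mem_insert_of_mem hj))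
      (fun i hi => hstart i (Finset.mem_insert_of_mem hi)) m (α m)
      (hstart m (Finset.mem_insert_self _ _))
      (fun i hi => hgap i (Finset.mem_insert_of_mem hi) m (Finset.mem_insert_self _ _) (hm i hi))
    have h2 := hk m (Finset.mem_insert_self _ _)
    rw [Finset.sum_insert hmI]
    linarith

/-- `PathIn G S a b n` says that `G` has a path on `n` vertices from `a` to `b`, all of whose
vertices lie in `S`. -/
def PathIn {V : Type*} (G : SimpleGraph V) (S : Set V) (a b : V) (n : ℕ) : Prop :=
  ∃ w : G.Walk a b, w.IsPath ∧ (∀ x ∈ w.support, x ∈ S) ∧ w.support.length = n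

namespace PathIn

variable {V W : Type*} {G : SimpleGraph V} {S T : Set V} {a b c d : V} {m n : ℕ}

theorem mono (h : PathIn G S a b n) (hST : S ⊆ T) : PathIn G T a b n := by
  obtain ⟨w, hw, hS, hn⟩ := h
  exact ⟨w, hw, fun x hx => hST (hS x hx), hn⟩

theorem symm (h : PathIn G S a b n) : PathIn G S b a n := by
  obtain ⟨w, hw, hS, hn⟩ := h
  exact ⟨w.reverse, hw.reverse, fun x hx => hS x (by simpa using hx), by simpa using hn⟩

theorem single (ha : a ∈ S) : PathIn G S a a 1 :=
  ⟨Walk.nil, by simp, by simpa using ha, by simp⟩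

theorem one_le (h : PathIn G S a b n) : 1 ≤ n := by
  obtain ⟨w, -, -, rfl⟩ := h
  simp

theorem join (h : PathIn G S a b m) (h' : PathIn G T c d n) (hST : Disjoint S T)
    (hbc : G.Adj b c) : PathIn G (S ∪ T) a d (m + n) := by
  obtain ⟨w, hw, hS, rfl⟩ := h
  obtain ⟨w', hw', hT, rfl⟩ := h'
  have hsupp : (w.append (Walk.cons hbc w')).support = w.support ++ w'.support := by
    simp [Walk.support_append]
  refine ⟨w.append (Walk.cons hbc w'), ?_, ?_, ?_⟩
  · rw [Walk.isPath_def, hsupp, List.nodup_append']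
    refine ⟨hw.support_nodup, hw'.support_nodup, ?_⟩
    intro x hx hx'
    exact Set.disjoint_left.1 hST (hS x hx) (hT x hx')
  · intro x hx
    rw [hsupp, List.mem_append] at hx
    exact hx.imp (hS x) (hT x)
  · rw [hsupp, List.length_append]

theorem of_seq (f : ℕ → V) (s d : ℕ) (hadj : ∀ k, s ≤ k → k < s + d → G.Adj (f k) (f (k + 1)))
    (hinj : Set.InjOn f (Set.Icc s (s + d))) :
    PathIn G (f '' Set.Icc s (s + d)) (f s) (f (s + d)) (d + 1) := by
  induction d with
  | zero => exact single ⟨s, by simp, rfl⟩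
  | succ d ih =>
    have h1 := ih (fun k hk hk' => hadj k hk (by omega))
      (hinj.mono (Set.Icc_subset_Icc_right (by omega)))
    have h2 : PathIn G {f (s + (d + 1))} (f (s + (d + 1))) (f (s + (d + 1))) 1 := single rfl
    refine (h1.join h2 ?_ (hadj (s + d) (by omega) (by omega))).mono ?_
    · rw [Set.disjoint_singleton_right]
      rintro ⟨k, hk, hkf⟩
      have := hinj ⟨hk.1, by have := hk.2; omega⟩ ⟨by omega, le_rfl⟩ hkf
      have := hk.2
      omega
    · apply Set.union_subset
      · exact Set.image_mono (Set.Icc_subset_Icc_right (by omega))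
      · rintro _ rfl
        exact ⟨_, ⟨by omega, le_rfl⟩, rfl⟩

theorem of_comap {f : W → V} {S : Set W} {a b : W} (h : PathIn (G.comap f) S a b n)
    (hf : Set.InjOn f S) (hT : Set.MapsTo f S T) : PathIn G T (f a) (f b) n := by
  obtain ⟨w, hw, hS, rfl⟩ := h
  let g : G.comap f →g G := ⟨f, fun h => h⟩
  refine ⟨w.map g, ?_, ?_, ?_⟩
  · rw [Walk.isPath_def, Walk.support_map]
    exact hw.support_nodup.map_on fun x hx y hy hxy => hf (hS x hx) (hS y hy) hxy
  · intro x hx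
    rw [Walk.support_map, List.mem_map] at hx
    obtain ⟨y, hy, rfl⟩ := hx
    exact hT (hS y hy)
  · simp

theorem exists_cycle (h : PathIn G S a b n) (hba : G.Adj b a) (hn : 3 ≤ n) :
    ∃ w : G.Walk b b, w.IsCycle ∧ w.length = n := by
  obtain ⟨w, hw, -, rfl⟩ := h
  refine ⟨Walk.cons hba w, ?_, by simp⟩
  rw [Walk.isCycle_iff_isPath_tail_and_le_length]
  refine ⟨by simpa using hw, ?_⟩
  simpa using hn

end PathIn

/-- The vertices of a comb: the spine `(0, 0), …, (p, 0)` and, above each `(i, 0)`, a tooth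
`(i, 1), …, (i, e i)`. -/
def combSet (p : ℕ) (e : ℕ → ℕ) : Set (ℕ × ℕ) := {q | q.1 ≤ p ∧ q.2 ≤ e q.1}

/-- The graph `K` contains the comb with spine of length `p` and teeth of lengths `e`. -/
structure IsComb (K : SimpleGraph (ℕ × ℕ)) (p : ℕ) (e : ℕ → ℕ) : Prop where
  row : ∀ i, i < p → K.Adj (i, 0) (i + 1, 0)
  col : ∀ i s, i ≤ p → s < e i → K.Adj (i, s) (i, s + 1)

namespace IsComb

variable {K : SimpleGraph (ℕ × ℕ)} {p : ℕ} {e : ℕ → ℕ}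

theorem row_path (h : IsComb K p e) {i j : ℕ} (hij : i ≤ j) (hj : j ≤ p) :
    PathIn K {q | i ≤ q.1 ∧ q.1 ≤ j ∧ q.2 = 0} (i, 0) (j, 0) (j - i + 1) := by
  obtain ⟨d, rfl⟩ := Nat.exists_eq_add_of_le hij
  have := PathIn.of_seq (G := K) (fun k => (k, 0)) i d
    (fun k _ hk => h.row k (by omega)) (fun x _ y _ hxy => by simpa using hxy)
  rw [Nat.add_sub_cancel_left]
  refine this.mono ?_
  rintro _ ⟨k, hk, rfl⟩
  exact ⟨hk.1, hk.2, rfl⟩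

theorem col_path_of_le (h : IsComb K p e) {j s t : ℕ} (hj : j ≤ p) (hst : s ≤ t)
    (ht : t ≤ e j) :
    PathIn K {q | q.1 = j ∧ s ≤ q.2 ∧ q.2 ≤ t} (j, s) (j, t) (t - s + 1) := by
  obtain ⟨d, rfl⟩ := Nat.exists_eq_add_of_le hst
  have := PathIn.of_seq (G := K) (fun k => (j, k)) s d
    (fun k _ hk => h.col j k hj (by omega)) (fun x _ y _ hxy => by simpa using hxy)
  rw [Nat.add_sub_cancel_left]
  refine this.mono ?_
  rintro _ ⟨k, hk, rfl⟩
  exact ⟨rfl, hk.1, hk.2⟩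

theorem col_path (h : IsComb K p e) {j s t : ℕ} (hj : j ≤ p) (hs : s ≤ e j) (ht : t ≤ e j)
    (hs1 : 1 ≤ s) (ht1 : 1 ≤ t) :
    PathIn K {q | q.1 = j ∧ 1 ≤ q.2 ∧ q.2 ≤ e j} (j, s) (j, t) (max s t - min s t + 1) := by
  rcases le_total s t with hst | hst
  · rw [max_eq_right hst, min_eq_left hst]
    exact (h.col_path_of_le hj hst ht).mono fun q hq => ⟨hq.1, hs1.trans hq.2.1, hq.2.2.trans ht⟩
  · rw [max_eq_left hst, min_eq_right hst]
    exact (h.col_path_of_le hj hst hs).symm.mono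
      fun q hq => ⟨hq.1, ht1.trans hq.2.1, hq.2.2.trans hs⟩

/-- A path hanging off the vertex `(i, t)` of a tooth extends along the tooth down to the
spine. -/
theorem attach (h : IsComb K p e) {S : Set (ℕ × ℕ)} {u w : ℕ × ℕ} {n i t : ℕ}
    (hS : PathIn K S u w n) (hi : i ≤ p) (ht : t ≤ e i) (hu : K.Adj (i, t) u)
    (hd : t = 0 ∨ ∀ q ∈ S, q.1 ≠ i) :
    ∃ a, K.Adj (i, 0) a ∧ PathIn K ({q | q.1 = i ∧ 1 ≤ q.2 ∧ q.2 ≤ t} ∪ S) a w (t + n) := by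
  rcases Nat.eq_zero_or_pos t with rfl | ht0
  · exact ⟨u, hu, by simpa using hS.mono Set.subset_union_right⟩
  · refine ⟨(i, 1), h.col i 0 hi (by omega), ?_⟩
    have h1 := h.col_path_of_le hi ht0 ht
    rw [Nat.sub_add_cancel ht0] at h1
    refine h1.join hS ?_ hu
    rw [Set.disjoint_left]
    intro q hq hq'
    exact hd.elim (fun h => by omega) (fun h => h q hq' hq.1)

variable (hmax : ∀ a b n, PathIn K (combSet p e) a b n → n ≤ p + 1)
include hmax

theorem detour_le (h : IsComb K p e) {S : Set (ℕ × ℕ)} {u w : ℕ × ℕ} {n i j : ℕ}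
    (hS : PathIn K S u w n) (hSc : S ⊆ combSet p e) (hS0 : ∀ q ∈ S, q.2 ≠ 0)
    (hij : i < j) (hj : j ≤ p) (hu : K.Adj (i, 0) u) (hw : K.Adj (j, 0) w) :
    n + 1 ≤ j - i := by
  have h1 := (h.row_path (Nat.zero_le i) (by omega)).join hS
    (Set.disjoint_left.2 fun q hq hq' => hS0 q hq' hq.2.2) hu
  have h2 := h1.join (h.row_path hj le_rfl) (by
    rw [Set.disjoint_left]
    rintro q (hq | hq) hq'
    · have := hq.2.1
      have := hq'.1
      omega
    · exact hS0 q hq hq'.2.2) hw.symm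
  have h3 := hmax _ _ _ (h2.mono (by
    rintro q ((hq | hq) | hq)
    · exact ⟨by have := hq.2.1; omega, by simp [hq.2.2]⟩
    · exact hSc hq
    · exact ⟨hq.2.1, by simp [hq.2.2]⟩))
  omega

theorem pendant_le (h : IsComb K p e) {S : Set (ℕ × ℕ)} {u w : ℕ × ℕ} {n i : ℕ}
    (hS : PathIn K S u w n) (hSc : S ⊆ combSet p e) (hS0 : ∀ q ∈ S, q.2 ≠ 0)
    (hi : i ≤ p) (hu : K.Adj (i, 0) u) : n ≤ i ∧ n + i ≤ p := by
  have h1 := (h.row_path (Nat.zero_le i) hi).join hS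
    (Set.disjoint_left.2 fun q hq hq' => hS0 q hq' hq.2.2) hu
  have h1' := hmax _ _ _ (h1.mono (by
    rintro q (hq | hq)
    · exact ⟨by have := hq.2.1; omega, by simp [hq.2.2]⟩
    · exact hSc hq))
  have h2 := (h.row_path hi le_rfl).symm.join hS
    (Set.disjoint_left.2 fun q hq hq' => hS0 q hq' hq.2.2) hu
  have h2' := hmax _ _ _ (h2.mono (by
    rintro q (hq | hq)
    · exact ⟨hq.2.1, by simp [hq.2.2]⟩
    · exact hSc hq))
  omega

/-- If the spine of a comb is a longest path, then the attachments of a tooth `j` to the other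
teeth take up room on the spine. -/
theorem sum_attachments_le (h : IsComb K p e) {j : ℕ} (hj : j ≤ p) (I : Finset ℕ)
    (a b t : ℕ → ℕ) (hjI : j ∈ I) (hI : ∀ i ∈ I, i ≤ p) (ht : ∀ i ∈ I, t i ≤ e i) (htj : t j = 0)
    (ha1 : ∀ i ∈ I, 1 ≤ a i) (hae : ∀ i ∈ I, a i ≤ e j)
    (hb1 : ∀ i ∈ I, 1 ≤ b i) (hbe : ∀ i ∈ I, b i ≤ e j)
    (haA : ∀ i ∈ I, K.Adj (i, t i) (j, a i)) (hbA : ∀ i ∈ I, K.Adj (i, t i) (j, b i)) :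
    (e j : ℤ) - 1 + ∑ i ∈ I, ((b i : ℤ) - a i + 2 + 2 * t i) ≤ p := by
  have hej : 1 ≤ e j := (ha1 j hjI).trans (hae j hjI)
  have hd : ∀ i, t i = 0 ∨ ∀ q ∈ {q : ℕ × ℕ | q.1 = j ∧ 1 ≤ q.2 ∧ q.2 ≤ e j}, q.1 ≠ i := by
    intro i
    by_cases hij : i = j
    · exact Or.inl (hij ▸ htj)
    · exact Or.inr fun q hq hqi => hij (hqi.symm.trans hq.1)
  have hsub : ∀ i ∈ I, {q : ℕ × ℕ | q.1 = i ∧ 1 ≤ q.2 ∧ q.2 ≤ t i} ⊆ combSet p e := by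
    rintro i hi q ⟨rfl, -, hq⟩
    exact ⟨hI _ hi, hq.trans (ht _ hi)⟩
  have hsubj : {q : ℕ × ℕ | q.1 = j ∧ 1 ≤ q.2 ∧ q.2 ≤ e j} ⊆ combSet p e := by
    rintro q ⟨rfl, -, hq⟩
    exact ⟨hj, hq⟩
  have key := add_sum_le_of_gaps I (fun i => 1 - (a i : ℤ) + t i) (fun i => b i + 1 + t i) (e j)
    ?_ ?_ p (-1) ?_ ?_
  · calc (e j : ℤ) - 1 + ∑ i ∈ I, ((b i : ℤ) - a i + 2 + 2 * t i)
        = (e j : ℤ) + -1 + ∑ i ∈ I, ((1 - (a i : ℤ) + t i) + (b i + 1 + t i)) := by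
          congr 1
          exact Finset.sum_congr rfl fun i _ => by ring
      _ ≤ p := key
  · intro i hi k hk hik
    have h1 := h.col_path hj (hae k hk) (hbe i hi) (ha1 k hk) (hb1 i hi)
    obtain ⟨u, hu, h2⟩ := h.attach h1 (hI k hk) (ht k hk) (haA k hk) (hd k)
    obtain ⟨w, hw, h3⟩ := h.attach h2.symm (hI i hi) (ht i hi) (hbA i hi) (by
      refine (hd i).imp_right fun H q hq => ?_
      rcases hq with hq | hq
      · have := hq.1
        omega
      · exact H q hq)
    have h4 := h.detour_le hmax h3
      (Set.union_subset (hsub i hi) (Set.union_subset (hsub k hk) hsubj))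
      (by rintro q (hq | hq | hq) <;> have := hq.2.1 <;> omega) hik (hI k hk) hw hu
    omega
  · intro i hi
    have h1 := h.col_path hj (hae i hi) le_rfl (ha1 i hi) hej
    obtain ⟨u, hu, h2⟩ := h.attach h1 (hI i hi) (ht i hi) (haA i hi) (hd i)
    have h3 := h.pendant_le hmax h2 (Set.union_subset (hsub i hi) hsubj)
      (by rintro q (hq | hq) <;> have := hq.2.1 <;> omega) (hI i hi) hu
    have := hae i hi
    omega
  · have h1 := h.col_path hj hej le_rfl le_rfl hej
    have h3 := h.pendant_le hmax h1 hsubj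
      (by rintro q hq; have := hq.2.1; omega) hj (h.col j 0 hj hej)
    omega
  · intro i hi
    have h1 := h.col_path hj (hbe i hi) hej (hb1 i hi) le_rfl
    obtain ⟨u, hu, h2⟩ := h.attach h1 (hI i hi) (ht i hi) (hbA i hi) (hd i)
    have h3 := h.pendant_le hmax h2 (Set.union_subset (hsub i hi) hsubj)
      (by rintro q (hq | hq) <;> have := hq.2.1 <;> omega) (hI i hi) hu
    have := hb1 i hi
    omega

omit hmax in
open scoped Classical in
theorem exists_attachment {j i : ℕ} (hej : 1 ≤ e j)
    (hpos : 0 < {s ∈ Finset.range (e i + 1) | K.Adj (j, e j) (i, s)}.card +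
      if e i = 0 then {s ∈ Finset.Icc 1 (e j) | K.Adj (i, 0) (j, s)}.card else 0) :
    ∃ a b t : ℕ, t ≤ e i ∧ 1 ≤ a ∧ a ≤ e j ∧ 1 ≤ b ∧ b ≤ e j ∧ K.Adj (i, t) (j, a) ∧
      K.Adj (i, t) (j, b) ∧
      ((({s ∈ Finset.range (e i + 1) | K.Adj (j, e j) (i, s)}.card +
        if e i = 0 then {s ∈ Finset.Icc 1 (e j) | K.Adj (i, 0) (j, s)}.card else 0 : ℕ)) : ℤ)
        ≤ (b : ℤ) - a + 2 + 2 * t := by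
  by_cases hi : e i = 0
  · rw [if_pos hi] at hpos ⊢
    set Z := {s ∈ Finset.Icc 1 (e j) | K.Adj (i, 0) (j, s)} with hZ
    have hA : {s ∈ Finset.range (e i + 1) | K.Adj (j, e j) (i, s)}.card ≤ 1 :=
      (Finset.card_filter_le _ _).trans (by simp [hi])
    have hne : Z.Nonempty := by
      by_contra hne
      rw [Finset.not_nonempty_iff_eq_empty] at hne
      rw [hne, Finset.card_empty, add_zero, Finset.card_pos] at hpos
      obtain ⟨s, hs⟩ := hpos
      rw [Finset.mem_filter, Finset.mem_range] at hs
      obtain rfl : s = 0 := by omega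
      have : e j ∈ Z := by
        rw [hZ, Finset.mem_filter, Finset.mem_Icc]
        exact ⟨⟨hej, le_rfl⟩, hs.2.symm⟩
      simp [hne] at this
    have hmin := Z.min'_mem hne
    have hmax := Z.max'_mem hne
    have hcard : Z.card ≤ Z.max' hne + 1 - Z.min' hne := by
      rw [← Nat.card_Icc]
      exact Finset.card_le_card fun s hs =>
        Finset.mem_Icc.2 ⟨Z.min'_le s hs, Z.le_max' s hs⟩
    have hle := Z.min'_le _ hmax
    generalize Z.min' hne = a at *
    generalize Z.max' hne = b at *
    rw [hZ, Finset.mem_filter, Finset.mem_Icc] at hmin hmax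
    refine ⟨a, b, 0, by omega, hmin.1.1, hmin.1.2, hmax.1.1, hmax.1.2, hmin.2, hmax.2, ?_⟩
    omega
  · rw [if_neg hi, add_zero] at hpos ⊢
    set Z := {s ∈ Finset.range (e i + 1) | K.Adj (j, e j) (i, s)} with hZ
    have hne : Z.Nonempty := Finset.card_pos.1 hpos
    have hmax := Z.max'_mem hne
    have hcard : Z.card ≤ Z.max' hne + 1 := by
      rw [← Finset.card_range (Z.max' hne + 1)]
      exact Finset.card_le_card fun s hs =>
        Finset.mem_range.2 (Nat.lt_succ_of_le (Z.le_max' s hs))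
    generalize Z.max' hne = t at *
    rw [hZ, Finset.mem_filter, Finset.mem_range] at hmax
    refine ⟨e j, e j, t, by omega, hej, le_rfl, hej, le_rfl, hmax.2.symm, hmax.2.symm, ?_⟩
    omega

open scoped Classical in
/-- The degree of the tip of a nontrivial tooth `j`, together with the number of edges from the
trivial teeth to the interior of the tooth `j`. -/
theorem tooth_degree_le (h : IsComb K p e) {j : ℕ} (hj : j ≤ p) (hej : 1 ≤ e j) :
    {s ∈ Finset.range (e j + 1) | K.Adj (j, e j) (j, s)}.card +
      ∑ i ∈ (Finset.range (p + 1)).erase j,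
        ({s ∈ Finset.range (e i + 1) | K.Adj (j, e j) (i, s)}.card +
          if e i = 0 then {s ∈ Finset.Icc 1 (e j) | K.Adj (i, 0) (j, s)}.card else 0) ≤ p := by
  have hjj : {s ∈ Finset.range (e j + 1) | K.Adj (j, e j) (j, s)}.card ≤ e j := by
    refine (Finset.card_le_card fun s hs => ?_).trans (Finset.card_range (e j)).le
    rw [Finset.mem_filter, Finset.mem_range] at hs
    have : s ≠ e j := by
      rintro rfl
      exact K.loopless.irrefl _ hs.2
    rw [Finset.mem_range]
    omega
  set val : ℕ → ℕ := fun i => {s ∈ Finset.range (e i + 1) | K.Adj (j, e j) (i, s)}.card +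
    if e i = 0 then {s ∈ Finset.Icc 1 (e j) | K.Adj (i, 0) (j, s)}.card else 0 with hval
  have hex : ∀ i, ∃ a b t : ℕ, (i = j ∧ a = 1 ∧ b = 1 ∧ t = 0) ∨ i ≠ j ∧ (0 < val i →
      (t ≤ e i ∧ 1 ≤ a ∧ a ≤ e j ∧ 1 ≤ b ∧ b ≤ e j ∧ K.Adj (i, t) (j, a) ∧
      K.Adj (i, t) (j, b) ∧ (val i : ℤ) ≤ (b : ℤ) - a + 2 + 2 * t)) := by
    intro i
    by_cases hij : i = j
    · exact ⟨1, 1, 0, Or.inl ⟨hij, rfl, rfl, rfl⟩⟩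
    · by_cases hpos : 0 < val i
      · obtain ⟨a, b, t, H⟩ := exists_attachment hej hpos
        exact ⟨a, b, t, Or.inr ⟨hij, fun _ => H⟩⟩
      · exact ⟨0, 0, 0, Or.inr ⟨hij, fun hp => absurd hp hpos⟩⟩
  choose a b t H using hex
  obtain ⟨-, haj, hbj, htj⟩ := (H j).resolve_right fun h => h.1 rfl
  set J := {i ∈ (Finset.range (p + 1)).erase j | val i ≠ 0} with hJ
  have hJj : j ∉ J := by simp [hJ]
  have HJ : ∀ i ∈ J, i ≤ p ∧ (t i ≤ e i ∧ 1 ≤ a i ∧ a i ≤ e j ∧ 1 ≤ b i ∧ b i ≤ e j ∧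
      K.Adj (i, t i) (j, a i) ∧
      K.Adj (i, t i) (j, b i) ∧ (val i : ℤ) ≤ (b i : ℤ) - a i + 2 + 2 * t i) := by
    intro i hi
    rw [hJ, Finset.mem_filter, Finset.mem_erase, Finset.mem_range] at hi
    exact ⟨by omega, ((H i).resolve_left fun h => hi.1.1 h.1).2 (Nat.pos_of_ne_zero hi.2)⟩
  have hadj : K.Adj (j, 0) (j, 1) := h.col j 0 hj hej
  have key := h.sum_attachments_le hmax hj (insert j J) a b t (Finset.mem_insert_self _ _)
    (Finset.forall_mem_insert .. |>.2 ⟨hj, fun i hi => (HJ i hi).1⟩)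
    (Finset.forall_mem_insert .. |>.2 ⟨by omega, fun i hi => (HJ i hi).2.1⟩) htj
    (Finset.forall_mem_insert .. |>.2 ⟨by omega, fun i hi => (HJ i hi).2.2.1⟩)
    (Finset.forall_mem_insert .. |>.2 ⟨by omega, fun i hi => (HJ i hi).2.2.2.1⟩)
    (Finset.forall_mem_insert .. |>.2 ⟨by omega, fun i hi => (HJ i hi).2.2.2.2.1⟩)
    (Finset.forall_mem_insert .. |>.2 ⟨by omega, fun i hi => (HJ i hi).2.2.2.2.2.1⟩)
    (Finset.forall_mem_insert .. |>.2 ⟨by rwa [htj, haj], fun i hi => (HJ i hi).2.2.2.2.2.2.1⟩)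
    (Finset.forall_mem_insert .. |>.2 ⟨by rwa [htj, hbj], fun i hi => (HJ i hi).2.2.2.2.2.2.2.1⟩)
  rw [Finset.sum_insert hJj, haj, hbj, htj] at key
  have hsum : ((∑ i ∈ (Finset.range (p + 1)).erase j, val i : ℕ) : ℤ) ≤
      ∑ i ∈ J, ((b i : ℤ) - a i + 2 + 2 * t i) := by
    rw [← Finset.sum_filter_ne_zero, Nat.cast_sum]
    exact Finset.sum_le_sum fun i hi => (HJ i hi).2.2.2.2.2.2.2.2
  push_cast at key hsum ⊢
  linarith

open scoped Classical in
/-- If the spine of a comb is a longest path, then the tips of its teeth have average degree at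
most the length of the spine. -/
theorem sum_degree_le (h : IsComb K p e) :
    ∑ i ∈ Finset.range (p + 1), ∑ k ∈ Finset.range (p + 1),
      {s ∈ Finset.range (e k + 1) | K.Adj (i, e i) (k, s)}.card ≤ (p + 1) * p := by
  set A : ℕ → ℕ → ℕ := fun i k => {s ∈ Finset.range (e k + 1) | K.Adj (i, e i) (k, s)}.card
    with hA
  set c : ℕ → ℕ → ℕ := fun i j => {s ∈ Finset.Icc 1 (e j) | K.Adj (i, 0) (j, s)}.card with hc
  set R := Finset.range (p + 1) with hR
  have htriv : ∀ i ∈ R, e i = 0 →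
      ∑ k ∈ R, A i k ≤ p + ∑ k ∈ R with e k ≠ 0, c i k := by
    intro i hi hei
    have hAii : A i i = 0 := by
      rw [hA, Finset.card_eq_zero, Finset.filter_eq_empty_iff]
      intro s hs hadj
      rw [Finset.mem_range] at hs
      obtain rfl : s = e i := by omega
      exact K.loopless.irrefl _ hadj
    have hAik : ∀ k, A i k ≤ 1 + c i k := by
      intro k
      have hsub : {s ∈ Finset.range (e k + 1) | K.Adj (i, e i) (k, s)} ⊆
          insert 0 {s ∈ Finset.Icc 1 (e k) | K.Adj (i, 0) (k, s)} := by
        intro s hs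
        rw [hei, Finset.mem_filter, Finset.mem_range] at hs
        rw [Finset.mem_insert, Finset.mem_filter, Finset.mem_Icc]
        rcases Nat.eq_zero_or_pos s with h0 | h0
        · exact Or.inl h0
        · exact Or.inr ⟨⟨h0, by omega⟩, hs.2⟩
      have := (Finset.card_le_card hsub).trans (Finset.card_insert_le _ _)
      simp only [hA, hc]
      omega
    have hc0 : ∀ k, e k = 0 → c i k = 0 := fun k hk => by simp [hc, hk]
    calc ∑ k ∈ R, A i k = ∑ k ∈ R.erase i, A i k := by
          rw [← Finset.add_sum_erase R _ hi, hAii, zero_add]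
      _ ≤ ∑ k ∈ R.erase i, (1 + c i k) := Finset.sum_le_sum fun k _ => hAik k
      _ = p + ∑ k ∈ R.erase i, c i k := by
          rw [Finset.sum_add_distrib, Finset.sum_const, Finset.card_erase_of_mem hi, hR,
            Finset.card_range]
          simp
      _ ≤ p + ∑ k ∈ R, c i k := by
          gcongr
          exact Finset.erase_subset _ _
      _ = p + ∑ k ∈ R with e k ≠ 0, c i k := by
          congr 1
          rw [Finset.sum_filter]
          refine Finset.sum_congr rfl fun k _ => ?_
          split_ifs with hk
          · rfl
          · exact hc0 k (not_not.1 hk)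
  have hnontriv : ∀ j ∈ R, e j ≠ 0 →
      ∑ k ∈ R, A j k + ∑ i ∈ R with e i = 0, c i j ≤ p := by
    intro j hj hej
    have h1 := h.tooth_degree_le hmax (Nat.lt_succ_iff.1 (Finset.mem_range.1 hj))
      (Nat.pos_of_ne_zero hej)
    rw [Finset.sum_add_distrib, ← add_assoc] at h1
    rw [← Finset.add_sum_erase R _ hj]
    refine le_trans (Nat.add_le_add_left ?_ _) h1
    rw [Finset.sum_filter, ← Finset.add_sum_erase R _ hj, if_neg hej, zero_add]
  have hsplit : ∀ f : ℕ → ℕ, ∑ i ∈ R, f i = ∑ i ∈ R with e i = 0, f i +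
      ∑ i ∈ R with e i ≠ 0, f i := fun f => (Finset.sum_filter_add_sum_filter_not R _ f).symm
  calc ∑ i ∈ R, ∑ k ∈ R, A i k
      = ∑ i ∈ R with e i = 0, ∑ k ∈ R, A i k + ∑ i ∈ R with e i ≠ 0, ∑ k ∈ R, A i k :=
        hsplit _
    _ ≤ ∑ i ∈ R with e i = 0, (p + ∑ k ∈ R with e k ≠ 0, c i k) +
        ∑ i ∈ R with e i ≠ 0, ∑ k ∈ R, A i k := by
        refine Nat.add_le_add_right (Finset.sum_le_sum fun i hi => ?_) _
        rw [Finset.mem_filter] at hi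
        exact htriv i hi.1 hi.2
    _ = ∑ i ∈ R with e i = 0, p +
        ∑ j ∈ R with e j ≠ 0, (∑ k ∈ R, A j k + ∑ i ∈ R with e i = 0, c i j) := by
        rw [Finset.sum_add_distrib, Finset.sum_add_distrib,
          Finset.sum_comm (s := {i ∈ R | e i = 0})]
        ring
    _ ≤ ∑ i ∈ R with e i = 0, p + ∑ j ∈ R with e j ≠ 0, p := by
        refine Nat.add_le_add_left (Finset.sum_le_sum fun j hj => ?_) _
        rw [Finset.mem_filter] at hj
        exact hnontriv j hj.1 hj.2
    _ = (p + 1) * p := by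
        rw [← hsplit fun _ => p]
        simp [hR]

omit hmax in
theorem exists_tip_path_aux (h : IsComb K p e) {i d : ℕ} (hd : i + d ≤ p) :
    PathIn K {q ∈ combSet p e | q.1 ≤ i + d}
      (i, e i) (i + d, 0) (e i + d + 1) := by
  induction d with
  | zero =>
    refine (h.col_path_of_le (by omega) (Nat.zero_le _) le_rfl).symm.mono ?_
    rintro q ⟨rfl, -, hq⟩
    exact ⟨⟨hd, hq⟩, by simp⟩
  | succ d ih =>
    have h1 := (ih (by omega)).join
      (PathIn.single (G := K) (a := (i + d + 1, 0)) (Set.mem_singleton _)) ?_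
      (h.row (i + d) (by omega))
    · refine h1.mono ?_
      rintro q (⟨hq, hqi⟩ | rfl)
      · exact ⟨hq, by omega⟩
      · exact ⟨⟨hd, Nat.zero_le _⟩, le_rfl⟩
    · rw [Set.disjoint_singleton_right]
      rintro ⟨-, hq⟩
      simp at hq

omit hmax in
/-- The tips of two teeth are joined by a path at least as long as their distance on the
spine. -/
theorem exists_tip_path (h : IsComb K p e) {i j : ℕ} (hij : i ≤ j) (hj : j ≤ p) :
    ∃ n, j - i + 1 ≤ n ∧ PathIn K (combSet p e) (i, e i) (j, e j) n := by
  obtain ⟨d, rfl⟩ := Nat.exists_eq_add_of_le hij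
  rcases d with - | d
  · exact ⟨1, by simp, PathIn.single ⟨hj, le_rfl⟩⟩
  · have h1 := (h.exists_tip_path_aux (i := i) (d := d) (by omega)).join
      (h.col_path_of_le hj (Nat.zero_le _) le_rfl) ?_ (h.row (i + d) (by omega))
    · refine ⟨_, ?_, h1.mono ?_⟩
      · omega
      · rintro q (hq | ⟨hq, -, hq'⟩)
        · exact hq.1
        · exact ⟨hq ▸ hj, hq ▸ hq'⟩
    · rw [Set.disjoint_left]
      rintro q ⟨-, hq⟩ ⟨hq', -⟩
      omega

end IsComb

section LongestPath

variable {V : Type*} {G : SimpleGraph V} {H : Set V} {p : ℕ}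

theorem IsComb.extend {z : ℕ × ℕ → V} {e : ℕ → ℕ} (h : IsComb (G.comap z) p e)
    (hinj : Set.InjOn z (combSet p e)) (hmap : Set.MapsTo z (combSet p e) H) {i : ℕ} (hi : i ≤ p)
    {w : V} (hw : w ∈ H) (hadj : G.Adj (z (i, e i)) w) (hnew : w ∉ z '' combSet p e) :
    ∃ (z' : ℕ × ℕ → V) (e' : ℕ → ℕ), IsComb (G.comap z') p e' ∧ Set.InjOn z' (combSet p e') ∧
      Set.MapsTo z' (combSet p e') H ∧
      ∑ k ∈ Finset.range (p + 1), e' k = ∑ k ∈ Finset.range (p + 1), e k + 1 := by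
  classical
  set z' := Function.update z (i, e i + 1) w with hz'
  set e' := Function.update e i (e i + 1) with he'
  have hz'w : z' (i, e i + 1) = w := by simp [hz']
  have hz'z : ∀ q ∈ combSet p e, z' q = z q := by
    rintro q ⟨-, hq⟩
    refine Function.update_of_ne ?_ _ _
    rintro rfl
    simp at hq
  have hcomb : combSet p e' ⊆ insert (i, e i + 1) (combSet p e) := by
    rintro ⟨k, s⟩ ⟨hk, hs⟩
    by_cases hki : k = i
    · subst hki
      simp only [he', Function.update_self] at hs
      rcases Nat.lt_or_ge s (e k + 1) with hs' | hs'
      · exact Or.inr ⟨hk, Nat.lt_succ_iff.1 hs'⟩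
      · obtain rfl : s = e k + 1 := by omega
        exact Or.inl rfl
    · simp only [he', Function.update_of_ne hki] at hs
      exact Or.inr ⟨hk, hs⟩
  have hinj' : Set.InjOn z' (insert (i, e i + 1) (combSet p e)) := by
    rw [Set.injOn_insert (fun hmem => by simpa using hmem.2)]
    refine ⟨fun x hx y hy hxy => hinj hx hy (by rwa [hz'z x hx, hz'z y hy] at hxy), ?_⟩
    rw [hz'w]
    rintro ⟨q, hq, hqw⟩
    exact hnew ⟨q, hq, (hz'z q hq).symm.trans hqw⟩
  refine ⟨z', e', ⟨?_, ?_⟩, hinj'.mono hcomb, ?_, ?_⟩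
  · intro k hk
    rw [comap_adj, hz'z (k, 0) ⟨hk.le, Nat.zero_le _⟩, hz'z (k + 1, 0) ⟨hk, Nat.zero_le _⟩]
    exact h.row k hk
  · intro k s hk hs
    rw [comap_adj]
    by_cases hlast : k = i ∧ s = e i
    · obtain ⟨rfl, rfl⟩ := hlast
      rwa [hz'w, hz'z _ ⟨hk, le_rfl⟩]
    · have hs' : s < e k := by
        by_cases hki : k = i
        · subst hki
          simp only [he', Function.update_self] at hs
          omega
        · simpa only [he', Function.update_of_ne hki] using hs
      rw [hz'z (k, s) ⟨hk, hs'.le⟩, hz'z (k, s + 1) ⟨hk, hs'⟩]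
      exact h.col k s hk hs'
  · intro q hq
    rcases hcomb hq with rfl | hq
    · rwa [hz'w]
    · rw [hz'z q hq]
      exact hmap hq
  · have hiR : i ∈ Finset.range (p + 1) := Finset.mem_range.2 (by omega)
    rw [← Finset.add_sum_erase _ _ hiR, ← Finset.add_sum_erase _ e hiR]
    simp only [he', Function.update_self]
    rw [Finset.sum_congr rfl fun k hk => Function.update_of_ne (Finset.ne_of_mem_erase hk) _ _]
    omega

open scoped Classical in
/-- If `p` is the length of a longest path in `G[H]`, then `H` contains vertices `y 0, …, y p` of
average degree at most `p` in `G[H]` such that `y i` and `y j` are joined by a path of length at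
least `|i - j|`. -/
theorem exists_spread_vertices [Fintype V] (hmax : ∀ a b n, PathIn G H a b n → n ≤ p + 1)
    (hex : ∃ a b, PathIn G H a b (p + 1)) :
    ∃ y : ℕ → V,
      (∀ i j, i ≤ j → j ≤ p → ∃ n, j - i + 1 ≤ n ∧ PathIn G H (y i) (y j) n) ∧
      ∑ i ∈ Finset.range (p + 1), {w | w ∈ H ∧ G.Adj (y i) w}.ncard ≤ (p + 1) * p := by
  set N : Set ℕ := {m | ∃ (z : ℕ × ℕ → V) (e : ℕ → ℕ), IsComb (G.comap z) p e ∧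
    Set.InjOn z (combSet p e) ∧ Set.MapsTo z (combSet p e) H ∧
    ∑ k ∈ Finset.range (p + 1), e k = m} with hN
  have hne : N.Nonempty := by
    obtain ⟨a, b, w, hw, hwH, hlen⟩ := hex
    rw [Walk.length_support] at hlen
    refine ⟨0, fun q => w.getVert q.1, fun _ => 0, ⟨?_, ?_⟩, ?_, ?_, by simp⟩
    · intro i hi
      exact w.adj_getVert_succ (by omega)
    · intro i s _ hs
      simp at hs
    · rintro ⟨i, s⟩ ⟨hi, hs⟩ ⟨j, t⟩ ⟨hj, ht⟩ hij
      simp only at hi hj hij hs ht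
      have := hw.getVert_injOn (show i ≤ w.length by omega) (show j ≤ w.length by omega) hij
      ext <;> simp <;> omega
    · rintro q -
      exact hwH _ (w.getVert_mem_support _)
  have hbdd : BddAbove N := by
    refine ⟨Fintype.card V, ?_⟩
    rintro m ⟨z, e, -, hinj, -, rfl⟩
    calc ∑ k ∈ Finset.range (p + 1), e k
        ≤ ∑ k ∈ Finset.range (p + 1), (Finset.range (e k + 1)).card :=
          Finset.sum_le_sum fun k _ => by simp
      _ = ((Finset.range (p + 1)).sigma fun k => Finset.range (e k + 1)).card :=
          (Finset.card_sigma _ _).symm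
      _ ≤ (Finset.univ : Finset V).card := by
          refine Finset.card_le_card_of_injOn (fun q => z (q.1, q.2)) (by simp) ?_
          rintro ⟨i, s⟩ hi ⟨j, t⟩ hj hij
          simp only [Finset.coe_sigma, Set.mem_sigma_iff, Finset.mem_coe, Finset.mem_range]
            at hi hj
          have := hinj (show (i, s) ∈ combSet p e from ⟨by simp; omega, by simp; omega⟩)
            (show (j, t) ∈ combSet p e from ⟨by simp; omega, by simp; omega⟩) hij
          simp only [Prod.mk.injEq] at this
          obtain ⟨rfl, rfl⟩ := this
          rfl
      _ = Fintype.card V := Finset.card_univ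
  obtain ⟨z, e, hcomb, hinj, hmap, hsum⟩ := Nat.sSup_mem hne hbdd
  have hmaxK : ∀ a b n, PathIn (G.comap z) (combSet p e) a b n → n ≤ p + 1 :=
    fun a b n h => hmax _ _ _ (h.of_comap hinj hmap)
  refine ⟨fun i => z (i, e i), ?_, ?_⟩
  · intro i j hij hj
    obtain ⟨n, hn, hP⟩ := hcomb.exists_tip_path hij hj
    exact ⟨n, hn, hP.of_comap hinj hmap⟩
  · refine le_trans (Finset.sum_le_sum fun i hi => ?_) (hcomb.sum_degree_le hmaxK)
    have hip : i ≤ p := Nat.lt_succ_iff.1 (Finset.mem_range.1 hi)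
    rw [Set.ncard_eq_toFinset_card']
    calc {w | w ∈ H ∧ G.Adj (z (i, e i)) w}.toFinset.card
        ≤ ((Finset.range (p + 1)).biUnion fun k =>
            ({s ∈ Finset.range (e k + 1) | (G.comap z).Adj (i, e i) (k, s)}.image
              fun s => z (k, s))).card := by
          refine Finset.card_le_card fun w hw => ?_
          rw [Set.mem_toFinset] at hw
          have hold : w ∈ z '' combSet p e := by
            by_contra hnew
            obtain ⟨z', e', h1, h2, h3, h4⟩ := hcomb.extend hinj hmap hip hw.1 hw.2 hnew
            have := le_csSup hbdd (show _ ∈ N from ⟨z', e', h1, h2, h3, rfl⟩)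
            omega
          obtain ⟨⟨k, s⟩, ⟨hk, hs⟩, rfl⟩ := hold
          simp only [Finset.mem_biUnion, Finset.mem_image, Finset.mem_filter, Finset.mem_range]
          exact ⟨k, Nat.lt_succ_of_le hk, s, ⟨Nat.lt_succ_of_le hs, hw.2⟩, rfl⟩
      _ ≤ ∑ k ∈ Finset.range (p + 1),
            {s ∈ Finset.range (e k + 1) | (G.comap z).Adj (i, e i) (k, s)}.card :=
          Finset.card_biUnion_le.trans (Finset.sum_le_sum fun k _ => Finset.card_image_le)

end LongestPath

section LongestCycle

variable {V : Type*} {G : SimpleGraph V} {H : Set V} {p n : ℕ} {c y : ℕ → V}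

/-- The neighbours of spread vertices off a longest cycle `c 0, …, c (n - 1)` force the cycle to be
long. -/
theorem sum_card_add_one_le [DecidableRel G.Adj] (hn : 3 ≤ n)
    (hlong : ∀ S a b m, PathIn G S a b m → G.Adj b a → 3 ≤ m → m ≤ n)
    (hc : Set.InjOn c (Set.Iio n)) (hadj : ∀ k, k + 1 < n → G.Adj (c k) (c (k + 1)))
    (hclose : G.Adj (c (n - 1)) (c 0)) (hH : ∀ k < n, c k ∉ H)
    (hy : ∀ i j, i ≤ j → j ≤ p → ∃ m, j - i + 1 ≤ m ∧ PathIn G H (y i) (y j) m) :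
    ∑ k ∈ Finset.range n with ({i ∈ Finset.range (p + 1) | G.Adj (y i) (c k)}.Nonempty),
      ({i ∈ Finset.range (p + 1) | G.Adj (y i) (c k)}.card + 1) ≤ n := by
  set S : ℕ → Finset ℕ := fun k => {i ∈ Finset.range (p + 1) | G.Adj (y i) (c k)} with hS
  set I := {k ∈ Finset.range n | (S k).Nonempty} with hI
  have hy' : ∀ i j, i ≤ p → j ≤ p →
      ∃ m, j + 1 ≤ m + i ∧ i + 1 ≤ m + j ∧ PathIn G H (y i) (y j) m := by
    intro i j hi hj
    rcases le_total i j with hij | hij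
    · obtain ⟨m, hm, hP⟩ := hy i j hij hj
      exact ⟨m, by omega, by omega, hP⟩
    · obtain ⟨m, hm, hP⟩ := hy j i hij hi
      exact ⟨m, by omega, by omega, hP.symm⟩
  have harc : ∀ k l, k ≤ l → l < n →
      PathIn G (c '' Set.Icc k l) (c k) (c l) (l - k + 1) := by
    intro k l hkl hl
    obtain ⟨d, rfl⟩ := Nat.exists_eq_add_of_le hkl
    rw [Nat.add_sub_cancel_left]
    exact PathIn.of_seq c k d (fun j _ hj => hadj j (by omega))
      (hc.mono fun j hj => lt_of_le_of_lt hj.2 hl)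
  have hdisj : ∀ k l, l < n → Disjoint (c '' Set.Icc k l) H := by
    intro k l hl
    rw [Set.disjoint_left]
    rintro _ ⟨j, hj, rfl⟩
    exact hH j (lt_of_le_of_lt hj.2 hl)
  have hin : ∀ k l i j, k ≤ l → l < n → i ∈ S l → j ∈ S k → (k < l ∨ i ≠ j) →
      (i : ℤ) - j + 2 ≤ n - (l - k) := by
    intro k l i j hkl hl hi hj hne
    rw [hS, Finset.mem_filter, Finset.mem_range] at hi hj
    obtain ⟨m, hm1, hm2, hP⟩ := hy' i j (by omega) (by omega)
    have h1 := (harc k l hkl hl).join hP (hdisj k l hl) hi.2.symm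
    have := hP.one_le
    have h2 := hlong _ _ _ _ h1 hj.2 (by omega)
    omega
  have hout : ∀ k l i j, k < l → l < n → i ∈ S k → j ∈ S l →
      (i : ℤ) - j + 2 ≤ l - k := by
    intro k l i j hkl hl hi hj
    rw [hS, Finset.mem_filter, Finset.mem_range] at hi hj
    obtain ⟨m, hm1, hm2, hP⟩ := hy' i j (by omega) (by omega)
    have hd : Disjoint (c '' Set.Icc l (n - 1)) (c '' Set.Icc 0 k) := by
      rw [Set.disjoint_left]
      rintro _ ⟨a, ha, rfl⟩ ⟨b, hb, hab⟩
      have ha1 := ha.1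
      have ha2 := ha.2
      have hb2 := hb.2
      have := hc (show b < n by omega) (show a < n by omega) hab
      omega
    have h1 := ((harc l (n - 1) (by omega) (by omega)).join
      (harc 0 k (Nat.zero_le _) (by omega)) hd hclose).join hP
      (Set.disjoint_union_left.2 ⟨hdisj _ _ (by omega), hdisj _ _ (by omega)⟩) hi.2.symm
    have := hP.one_le
    have h2 := hlong _ _ _ _ h1 hj.2 (by omega)
    omega
  rcases I.eq_empty_or_nonempty with hI0 | hI0
  · simp [hI0]
  have hex : ∀ k, ∃ a b : ℕ, k ∈ I → a ∈ S k ∧ b ∈ S k ∧ ((S k).card : ℤ) + 1 ≤ b - a + 2 := by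
    intro k
    by_cases hk : k ∈ I
    · have hne : (S k).Nonempty := (Finset.mem_filter.1 hk).2
      refine ⟨(S k).min' hne, (S k).max' hne, fun _ => ⟨Finset.min'_mem _ _,
        Finset.max'_mem _ _, ?_⟩⟩
      have h1 : (S k).card ≤ (S k).max' hne + 1 - (S k).min' hne := by
        rw [← Nat.card_Icc]
        exact Finset.card_le_card fun s hs =>
          Finset.mem_Icc.2 ⟨(S k).min'_le s hs, (S k).le_max' s hs⟩
      have h2 := (S k).min'_le _ ((S k).max'_mem hne)
      omega
    · exact ⟨0, 0, fun h => absurd h hk⟩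
  choose a b hab using hex
  have hIn : ∀ k ∈ I, k < n := fun k hk => Finset.mem_range.1 (Finset.mem_filter.1 hk).1
  set m := I.min' hI0 with hm
  have hmI : m ∈ I := I.min'_mem hI0
  have hmle : ∀ k ∈ I, m ≤ k := fun k hk => I.min'_le k hk
  have key := add_sum_le_of_gaps I (fun k => 1 - (a k : ℤ)) (fun k => b k + 1)
    ((m : ℤ) + a m - 1) ?_ ?_ (n + m) (1 - a m) ?_ ?_
  · have hle : ((∑ k ∈ I, ((S k).card + 1) : ℕ) : ℤ) ≤
        ∑ k ∈ I, ((1 - (a k : ℤ)) + (b k + 1)) := by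
      rw [Nat.cast_sum]
      refine Finset.sum_le_sum fun k hk => ?_
      have := (hab k hk).2.2
      push_cast
      linarith
    have hlen : ((∑ k ∈ I, ((S k).card + 1) : ℕ) : ℤ) ≤ n := by linarith
    exact Nat.cast_le.1 hlen
  · intro k hk l hl hkl
    have := hout k l _ _ hkl (hIn l hl) (hab k hk).2.1 (hab l hl).1
    linarith
  · intro k hk
    rcases (hmle k hk).eq_or_lt with rfl | hlt
    · omega
    · have := hout m k _ _ hlt (hIn k hk) (hab m hmI).1 (hab k hk).1
      linarith
  · omega
  · intro k hk
    by_cases hne : m < k ∨ b k ≠ a m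
    · have := hin m k _ _ (hmle k hk) (hIn k hk) (hab k hk).2.1 (hab m hmI).1 hne
      linarith
    · have := hmle k hk
      omega

/-- A longest cycle avoiding a set `H` of vertices that induces a longest path of length `p` has
length at least `(p + 2) * (δ - p)`. -/
theorem mul_minDegree_sub_le [Fintype V] [DecidableRel G.Adj] (hn : 3 ≤ n)
    (hlong : ∀ S a b m, PathIn G S a b m → G.Adj b a → 3 ≤ m → m ≤ n)
    (hc : Set.InjOn c (Set.Iio n)) (hadj : ∀ k, k + 1 < n → G.Adj (c k) (c (k + 1)))
    (hclose : G.Adj (c (n - 1)) (c 0)) (hH : ∀ v, v ∈ H ↔ ∀ k < n, c k ≠ v)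
    (hmax : ∀ a b n, PathIn G H a b n → n ≤ p + 1) (hex : ∃ a b, PathIn G H a b (p + 1)) :
    ((p : ℤ) + 2) * (G.minDegree - p) ≤ n := by
  classical
  obtain ⟨y, hy, hdeg⟩ := exists_spread_vertices hmax hex
  have hle := sum_card_add_one_le hn hlong hc hadj hclose
    (fun k hk hkH => (hH _).1 hkH k hk rfl) hy
  set R := Finset.range (p + 1) with hR
  set I := {k ∈ Finset.range n | ({i ∈ R | G.Adj (y i) (c k)}.Nonempty)} with hI
  set d : ℕ → ℕ := fun i => {w | w ∈ H ∧ G.Adj (y i) w}.ncard with hd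
  set D : ℕ → ℕ := fun i => {k ∈ Finset.range n | G.Adj (y i) (c k)}.card with hD
  have hdD : ∀ i, G.minDegree ≤ d i + D i := by
    intro i
    refine (G.minDegree_le_degree (y i)).trans ?_
    have hsub : G.neighborFinset (y i) ⊆ {w | w ∈ H ∧ G.Adj (y i) w}.toFinset ∪
        {k ∈ Finset.range n | G.Adj (y i) (c k)}.image c := by
      intro w hw
      rw [mem_neighborFinset] at hw
      rw [Finset.mem_union, Set.mem_toFinset, Finset.mem_image]
      by_cases hwH : w ∈ H
      · exact Or.inl ⟨hwH, hw⟩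
      · right
        rw [hH] at hwH
        push Not at hwH
        obtain ⟨k, hk, rfl⟩ := hwH
        exact ⟨k, Finset.mem_filter.2 ⟨Finset.mem_range.2 hk, hw⟩, rfl⟩
    calc G.degree (y i) = (G.neighborFinset (y i)).card := rfl
      _ ≤ _ := Finset.card_le_card hsub
      _ ≤ _ := Finset.card_union_le _ _
      _ ≤ d i + D i := by
        rw [← Set.ncard_eq_toFinset_card']
        exact Nat.add_le_add_left Finset.card_image_le _
  have hsumD : ∑ k ∈ I, {i ∈ R | G.Adj (y i) (c k)}.card = ∑ i ∈ R, D i := by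
    rw [hI, Finset.sum_filter_of_ne fun k _ hk => Finset.card_ne_zero.1 hk]
    exact (Finset.sum_card_bipartiteAbove_eq_sum_card_bipartiteBelow
      (fun i k => G.Adj (y i) (c k))).symm
  have hDI : ∀ i ∈ R, D i ≤ I.card := by
    intro i hi
    refine Finset.card_le_card fun k hk => ?_
    rw [Finset.mem_filter] at hk
    exact Finset.mem_filter.2 ⟨hk.1, i, Finset.mem_filter.2 ⟨hi, hk.2⟩⟩
  obtain ⟨i, hi, hip⟩ : ∃ i ∈ R, d i ≤ p := by
    refine Finset.exists_le_of_sum_le (g := fun _ => p) ⟨0, by simp [hR]⟩ ?_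
    rw [Finset.sum_const, smul_eq_mul, hR, Finset.card_range]
    exact hdeg
  rw [Finset.sum_add_distrib, hsumD, Finset.sum_const, smul_eq_mul, mul_one] at hle
  have h1 : (p + 1) * G.minDegree ≤ ∑ i ∈ R, d i + ∑ i ∈ R, D i := by
    rw [← Finset.sum_add_distrib]
    calc (p + 1) * G.minDegree = ∑ _i ∈ R, G.minDegree := by simp [hR]
      _ ≤ _ := Finset.sum_le_sum fun i _ => hdD i
  have h2 := hDI i hi
  have h3 := hdD i
  have h4 : G.minDegree ≤ p + I.card := by omega
  have h5 : (p + 1) * G.minDegree + G.minDegree ≤ (p + 1) * p + p + n := by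
    have : ∑ i ∈ R, d i ≤ (p + 1) * p := hdeg
    omega
  zify at h5
  linarith

end LongestCycle

/-- If `p̄` is the length of a longest path off a longest cycle `C`, then
`|C| ≥ (p̄ + 2) * (δ - p̄)`. -/
theorem minDegree_sub_mul_le_length {V : Type*} [Fintype V] [DecidableEq V] (G : SimpleGraph V)
    [DecidableRel G.Adj] {v : V} (C : G.Walk v v) (hC : IsLongestCycle G C) :
    (pbar (G.induce {x : V | x ∉ C.support}) + 2) *
      ((G.minDegree : ℤ) - pbar (G.induce {x : V | x ∉ C.support})) ≤ C.length := by
  obtain ⟨hcyc, hlong⟩ := hC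
  set H : Set V := {x : V | x ∉ C.support} with hH
  have hn : 3 ≤ C.length := hcyc.three_le_length
  have hinj : Set.InjOn C.getVert (Set.Iio C.length) :=
    hcyc.getVert_injOn'.mono fun k (hk : k < C.length) => show k ≤ C.length - 1 by omega
  have hmem : ∀ x, x ∈ H ↔ ∀ k < C.length, C.getVert k ≠ x := by
    intro x
    rw [hH, Set.mem_ofPred_eq, Walk.mem_support_iff_exists_getVert]
    constructor
    · rintro h k hk rfl
      exact h ⟨k, rfl, hk.le⟩
    · rintro h ⟨k, rfl, hk⟩
      rcases hk.lt_or_eq with hk | rfl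
      · exact h k hk rfl
      · exact h 0 (by omega) (by simp)
  by_cases hne : Nonempty H
  · set P : Set ℕ := {n : ℕ | ∃ (u v : H) (q : (G.induce H).Walk u v), q.IsPath ∧ q.length = n}
      with hP
    have hbdd : BddAbove P := by
      refine ⟨Fintype.card H, ?_⟩
      rintro m ⟨u, w, q, hq, rfl⟩
      exact hq.length_lt.le
    have hPne : P.Nonempty := ⟨0, hne.some, hne.some, Walk.nil, by simp, rfl⟩
    have hpbar : pbar (G.induce H) = ((sSup P : ℕ) : ℤ) := if_pos hne
    rw [hpbar]
    refine mul_minDegree_sub_le (c := C.getVert) (H := H) hn ?_ hinj ?_ ?_ hmem ?_ ?_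
    · intro S a b m hS hba hm
      obtain ⟨w, hw, rfl⟩ := hS.exists_cycle hba hm
      exact hlong _ w hw
    · intro k hk
      exact C.adj_getVert_succ (by omega)
    · have := C.adj_getVert_succ (i := C.length - 1) (by omega)
      rw [Nat.sub_add_cancel (by omega), Walk.getVert_length] at this
      rwa [Walk.getVert_zero]
    · rintro a b m ⟨w, hw, hwH, rfl⟩
      rw [Walk.length_support]
      refine Nat.succ_le_succ (le_csSup hbdd ⟨_, _, w.induce H hwH, ?_, ?_⟩)
      · refine Walk.IsPath.of_map (f := (Embedding.induce H).toHom) ?_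
        rwa [Walk.map_induce]
      · rw [← Walk.length_map (Embedding.induce H).toHom, Walk.map_induce]
        rfl
    · obtain ⟨u, w, q, hq, hlen⟩ := Nat.sSup_mem hPne hbdd
      refine ⟨_, _, q.map (Embedding.induce H).toHom,
        hq.map (Embedding.induce (G := G) H).injective, ?_, ?_⟩
      · intro x hx
        rw [Walk.support_map, List.mem_map] at hx
        obtain ⟨x', -, rfl⟩ := hx
        exact x'.2
      · rw [Walk.length_support, Walk.length_map, hlen]
  · have hpbar : pbar (G.induce H) = -1 := if_neg hne
    rw [hpbar]
    have h1 : Fintype.card V ≤ C.length := by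
      rw [← Finset.card_univ, ← Finset.card_range C.length]
      refine Finset.card_le_card_of_surjOn C.getVert fun x _ => ?_
      by_contra hx
      refine hne ⟨x, (hmem x).2 fun k hk hkx => hx ⟨k, by simpa using hk, hkx⟩⟩
    have h2 := (G.minDegree_le_degree v).trans_lt (G.degree_lt_card_verts v)
    push_cast
    linarith [(by exact_mod_cast h2.trans_le h1 : (G.minDegree : ℤ) + 1 ≤ C.length)]

/-- Theorem 5: if a longest cycle `C` satisfies
`min (l-2) (δ-l) ≤ p̄ ≤ max (l-2) (δ-l)`, then `|C| ≥ l(δ-l+2)`. -/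
theorem stmt_4 {V : Type*} [Fintype V] [DecidableEq V] (G : SimpleGraph V)
    [DecidableRel G.Adj] (l : ℕ) (hl : 1 ≤ l)
    {v : V} (C : G.Walk v v) (hC : IsLongestCycle G C)
    (hlo : min ((l : ℤ) - 2) ((G.minDegree : ℤ) - (l : ℤ)) ≤
      pbar (G.induce {x : V | x ∉ C.support}))
    (hhi : pbar (G.induce {x : V | x ∉ C.support}) ≤
      max ((l : ℤ) - 2) ((G.minDegree : ℤ) - (l : ℤ))) :
    (C.length : ℤ) ≥ (l : ℤ) * ((G.minDegree : ℤ) - (l : ℤ) + 2) := by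
  have h := minDegree_sub_mul_le_length G C hC
  generalize pbar (G.induce {x : V | x ∉ C.support}) = p at *
  refine le_trans ?_ h
  rcases le_total ((l : ℤ) - 2) ((G.minDegree : ℤ) - l) with hle | hle
  · rw [min_eq_left hle] at hlo
    rw [max_eq_right hle] at hhi
    nlinarith [mul_nonneg (sub_nonneg.2 hlo) (sub_nonneg.2 hhi)]
  · rw [min_eq_right hle] at hlo
    rw [max_eq_left hle] at hhi
    nlinarith [mul_nonneg (sub_nonneg.2 hlo) (sub_nonneg.2 hhi)]
end

section
/- Let λ ≥ 1 be an integer, let G be a finite simple graph with minimum degree δ, and let C be a longest cycle in G. If min{λ − 1, δ − λ + 1} ≤ c̄ ≤ max{λ − 1, δ − λ + 1}, where c̄ is the length of a longest cycle in the subgraph of G induced by the vertices not on C, then |C| ≥ λ(δ − λ + 2). -/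
open SimpleGraph

/-- `PathOn G S a b n`: there is a path from `a` to `b` in `G` with exactly `n` vertices,
all of which lie in `S`. -/
def PathOn {V : Type*} (G : SimpleGraph V) (S : Set V) (a b : V) (n : ℕ) : Prop :=
  ∃ p : G.Walk a b, p.IsPath ∧ p.length + 1 = n ∧ ∀ x ∈ p.support, x ∈ S

namespace PathOn

variable {V : Type*} {G : SimpleGraph V} {S T : Set V} {a b c d : V} {m n : ℕ}

lemma single (ha : a ∈ S) : PathOn G S a a 1 :=
  ⟨Walk.nil, by simp, by simp, by simpa using ha⟩

lemma mono (hST : S ⊆ T) (h : PathOn G S a b n) : PathOn G T a b n := by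
  obtain ⟨p, hp, hl, hs⟩ := h
  exact ⟨p, hp, hl, fun x hx => hST (hs x hx)⟩

lemma symm (h : PathOn G S a b n) : PathOn G S b a n := by
  obtain ⟨p, hp, hl, hs⟩ := h
  exact ⟨p.reverse, hp.reverse, by simpa using hl, by simpa using hs⟩

lemma trans (h : PathOn G S a b m) (hbc : G.Adj b c) (h' : PathOn G T c d n)
    (hST : Disjoint S T) : PathOn G (S ∪ T) a d (m + n) := by
  obtain ⟨p, hp, hl, hs⟩ := h
  obtain ⟨q, hq, hl', hs'⟩ := h'
  have hsup : (p.append (Walk.cons hbc q)).support = p.support ++ q.support := by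
    rw [Walk.support_append]; simp
  refine ⟨p.append (Walk.cons hbc q), ?_, ?_, ?_⟩
  · rw [Walk.isPath_def, hsup, List.nodup_append]
    refine ⟨hp.support_nodup, hq.support_nodup, ?_⟩
    rintro x hx y hy rfl
    exact Set.disjoint_left.1 hST (hs x hx) (hs' x hy)
  · simp only [Walk.length_append, Walk.length_cons]; omega
  · intro x hx
    rw [hsup, List.mem_append] at hx
    exact hx.imp (hs x) (hs' x)

lemma map {W : Type*} {H : SimpleGraph W} (f : G ↪g H) (h : PathOn G S a b n) :
    PathOn H (f '' S) (f a) (f b) n := by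
  obtain ⟨p, hp, hl, hs⟩ := h
  refine ⟨p.map f.toHom, hp.map f.injective, by simpa using hl, ?_⟩
  intro x hx
  rw [Walk.support_map, List.mem_map] at hx
  obtain ⟨y, hy, rfl⟩ := hx
  exact ⟨y, hs y hy, rfl⟩

lemma one_le (h : PathOn G S a b n) : 1 ≤ n := by
  obtain ⟨p, -, hl, -⟩ := h; omega

lemma exists_isCycle (h : PathOn G S a b n) (hba : G.Adj b a) (hn : 3 ≤ n) :
    ∃ (v : V) (C : G.Walk v v), C.IsCycle ∧ C.length = n := by
  obtain ⟨p, hp, hl, -⟩ := h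
  refine ⟨b, Walk.cons hba p, (Walk.cons_isCycle_iff _ _).2 ⟨hp, fun he => ?_⟩, by simpa using hl⟩
  rw [Sym2.eq_swap] at he
  have := hp.length_eq_one_of_mem_edges he
  omega

end PathOn

/-- A cyclic arrangement of `n` distinct vertices, consecutive ones being adjacent
(no adjacency is required when `n = 1`). -/
structure IsRing {V : Type*} (G : SimpleGraph V) {n : ℕ} (u : ZMod n → V) : Prop where
  inj : Function.Injective u
  adj : n ≠ 1 → ∀ i, G.Adj (u i) (u (i + 1))

/-- The arc of `m + 1` consecutive residues starting at `p`. -/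
def cyclicArc {n : ℕ} (p : ZMod n) (m : ℕ) : Set (ZMod n) :=
  {x | ∃ s ≤ m, x = p + (s : ℕ)}

lemma natCast_zmod_inj {n a b : ℕ} (ha : a < n) (hb : b < n) (h : (a : ZMod n) = b) : a = b := by
  rw [ZMod.natCast_eq_natCast_iff'] at h
  rwa [Nat.mod_eq_of_lt ha, Nat.mod_eq_of_lt hb] at h

lemma add_natCast_zmod_inj {n : ℕ} {p : ZMod n} {a b : ℕ} (ha : a < n) (hb : b < n)
    (h : p + (a : ℕ) = p + (b : ℕ)) : a = b :=
  natCast_zmod_inj ha hb (add_left_cancel h)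

lemma exists_eq_add_natCast {n : ℕ} [NeZero n] (i j : ZMod n) : ∃ m < n, j = i + (m : ℕ) :=
  ⟨(j - i).val, ZMod.val_lt _, by simp⟩

lemma exists_eq_add_natCast_pos {n : ℕ} [NeZero n] {i j : ZMod n} (h : j ≠ i) :
    ∃ m, 1 ≤ m ∧ m < n ∧ j = i + (m : ℕ) := by
  obtain ⟨m, hm, rfl⟩ := exists_eq_add_natCast i j
  refine ⟨m, ?_, hm, rfl⟩
  rcases Nat.eq_zero_or_pos m with rfl | h0
  · simp at h
  · exact h0

lemma add_natCast_sub {n : ℕ} (p : ZMod n) {m : ℕ} (hm : m ≤ n) :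
    p + (m : ℕ) + ((n - m : ℕ) : ZMod n) = p := by
  rw [Nat.cast_sub hm]; simp

lemma cyclicArc_disjoint {n : ℕ} {p : ZMod n} {q m m' : ℕ} (hq : m < q) (hn : q + m' < n) :
    Disjoint (cyclicArc p m) (cyclicArc (p + (q : ℕ)) m') := by
  rw [Set.disjoint_left]
  rintro x ⟨s, hs, rfl⟩ ⟨t, ht, h⟩
  have : p + (s : ℕ) = p + ((q + t : ℕ) : ZMod n) := by rw [h]; push_cast; ring
  have := add_natCast_zmod_inj (by omega) (by omega) this
  omega

lemma IsRing.pathOn {V : Type*} {G : SimpleGraph V} {n : ℕ} {u : ZMod n → V} (h : IsRing G u)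
    (p : ZMod n) {m : ℕ} (hm : m < n) :
    PathOn G (u '' cyclicArc p m) (u p) (u (p + (m : ℕ))) (m + 1) := by
  induction m with
  | zero => simpa only [Nat.cast_zero, add_zero, zero_add] using
      PathOn.single (G := G) (Set.mem_image_of_mem u (show p ∈ cyclicArc p 0 from ⟨0, le_rfl, by simp⟩))
  | succ m ih =>
    have hstep := (ih (by omega)).trans (h.adj (by omega) _)
      (PathOn.single (Set.mem_singleton (u (p + (m : ℕ) + 1)))) (by
        rw [Set.disjoint_singleton_right]
        rintro ⟨x, ⟨s, hs, rfl⟩, hx⟩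
        have hx := h.inj hx
        have : p + (s : ℕ) = p + ((m + 1 : ℕ) : ZMod n) := by rw [hx]; push_cast; ring
        have := add_natCast_zmod_inj (by omega) (by omega) this
        omega)
    have e : p + ((m + 1 : ℕ) : ZMod n) = p + (m : ℕ) + 1 := by push_cast; ring
    rw [e]
    refine hstep.mono ?_
    rintro x (⟨y, ⟨s, hs, rfl⟩, rfl⟩ | rfl)
    · exact ⟨_, ⟨s, by omega, rfl⟩, rfl⟩
    · exact ⟨_, ⟨m + 1, le_rfl, e.symm⟩, rfl⟩

lemma isRing_getVert {V : Type*} {G : SimpleGraph V} {v : V} {C : G.Walk v v} (hC : C.IsCycle) :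
    IsRing G (fun i : ZMod C.length => C.getVert i.val) ∧
      ∀ w ∈ C.support, ∃ i : ZMod C.length, C.getVert i.val = w := by
  have h3 := hC.three_le_length
  have : NeZero C.length := ⟨by omega⟩
  refine ⟨⟨?_, ?_⟩, ?_⟩
  · intro i j hij
    refine ZMod.val_injective _ (hC.getVert_injOn' ?_ ?_ hij)
    · have := ZMod.val_lt i; simp only [Set.mem_ofPred_eq]; omega
    · have := ZMod.val_lt j; simp only [Set.mem_ofPred_eq]; omega
  · intro _ i
    have hi := ZMod.val_lt i
    have := C.adj_getVert_succ hi
    have h1 : (1 : ZMod C.length).val = 1 := by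
      have : Fact (1 < C.length) := ⟨by omega⟩
      exact ZMod.val_one _
    by_cases hlt : i.val + 1 < C.length
    · have e : (i + 1).val = i.val + 1 := by
        rw [ZMod.val_add_of_lt] <;> rw [h1]; exact hlt
      simpa only [e] using this
    · have e : (i + 1).val = 0 := by
        rw [ZMod.val_add, h1, show i.val + 1 = C.length by omega, Nat.mod_self]
      rw [show i.val + 1 = C.length by omega, C.getVert_length] at this
      simpa only [e, C.getVert_zero] using this
  · intro w hw
    obtain ⟨k, rfl, hk⟩ := Walk.mem_support_iff_exists_getVert.1 hw
    by_cases hlt : k < C.length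
    · exact ⟨k, by rw [ZMod.val_natCast, Nat.mod_eq_of_lt hlt]⟩
    · refine ⟨0, ?_⟩
      rw [show k = C.length by omega]; simp

/-- `G` has no cycle on more than `c` vertices, an edge being regarded as a cycle on two
vertices. -/
def CircumferenceLE {V : Type*} (G : SimpleGraph V) (c : ℕ) : Prop :=
  ∀ (S : Set V) (a b : V) (n : ℕ), PathOn G S a b n → G.Adj b a → n ≤ c

/-- A ring of `c` vertices `y i 0` together with disjoint tails
`y i 0, y i 1, …, y i (e i)` attached to them. -/
structure TailSystem {W : Type*} (H : SimpleGraph W) (c : ℕ) where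
  e : ZMod c → ℕ
  y : ZMod c → ℕ → W
  inj : ∀ i j s t, s ≤ e i → t ≤ e j → y i s = y j t → i = j ∧ s = t
  adj_tail : ∀ i s, s < e i → H.Adj (y i s) (y i (s + 1))
  adj_ring : c ≠ 1 → ∀ i, H.Adj (y i 0) (y (i + 1) 0)

namespace TailSystem

variable {W : Type*} {H : SimpleGraph W} {c : ℕ} (T : TailSystem H c)

/-- The end of the tail at `i`. -/
def tip (i : ZMod c) : W := T.y i (T.e i)

/-- The vertices of the system with coordinates in `S`. -/
def img (S : Set (ZMod c × ℕ)) : Set W := {v | ∃ x ∈ S, x.2 ≤ T.e x.1 ∧ v = T.y x.1 x.2}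

/-- Two tails, up to the heights `s` and `t`, and the arc of the ring between them. -/
def ribbon (p : ZMod c) (m s t : ℕ) : Set (ZMod c × ℕ) :=
  {x | x.1 ∈ cyclicArc p m ∧ (x.2 = 0 ∨ x.1 = p ∧ x.2 ≤ s ∨ x.1 = p + (m : ℕ) ∧ x.2 ≤ t)}

lemma img_mono {S S' : Set (ZMod c × ℕ)} (h : S ⊆ S') : T.img S ⊆ T.img S' := by
  rintro v ⟨x, hx, h1⟩
  exact ⟨x, h hx, h1⟩

lemma img_union (S S' : Set (ZMod c × ℕ)) : T.img S ∪ T.img S' = T.img (S ∪ S') := by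
  ext v
  constructor
  · rintro (⟨x, hx, h⟩ | ⟨x, hx, h⟩)
    · exact ⟨x, Or.inl hx, h⟩
    · exact ⟨x, Or.inr hx, h⟩
  · rintro ⟨x, hx | hx, h⟩
    · exact Or.inl ⟨x, hx, h⟩
    · exact Or.inr ⟨x, hx, h⟩

lemma disjoint_img {S S' : Set (ZMod c × ℕ)} (h : Disjoint S S') :
    Disjoint (T.img S) (T.img S') := by
  rw [Set.disjoint_left]
  rintro v ⟨x, hx, hx', rfl⟩ ⟨z, hz, hz', hxz⟩
  obtain ⟨h1, h2⟩ := T.inj _ _ _ _ hx' hz' hxz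
  have : x = z := Prod.ext h1 h2
  exact Set.disjoint_left.1 h hx (this ▸ hz)

lemma isRing : IsRing H (fun i => T.y i 0) :=
  ⟨fun i j h => (T.inj i j 0 0 (Nat.zero_le _) (Nat.zero_le _) h).1, T.adj_ring⟩

lemma climb {S : Set (ZMod c × ℕ)} {a : W} {q : ZMod c} {s t n : ℕ}
    (h : PathOn H (T.img S) a (T.y q s) n) (hst : s ≤ t) (ht : t ≤ T.e q)
    (hS : ∀ r, s < r → (q, r) ∉ S) :
    PathOn H (T.img (S ∪ {x | x.1 = q ∧ s ≤ x.2 ∧ x.2 ≤ t})) a (T.y q t) (n + (t - s)) := by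
  induction t, hst using Nat.le_induction with
  | base => simpa using h.mono (T.img_mono Set.subset_union_left)
  | succ t hst ih =>
    have hstep := (ih (by omega)).trans (T.adj_tail q t ht)
      (PathOn.single (S := T.img {(q, t + 1)}) ⟨_, rfl, ht, rfl⟩) (T.disjoint_img (by
        rw [Set.disjoint_singleton_right]
        rintro (hx | ⟨-, -, hx⟩)
        · exact hS _ (by omega) hx
        · simp at hx))
    rw [T.img_union] at hstep
    rw [show n + (t + 1 - s) = n + (t - s) + 1 by omega]
    refine hstep.mono (T.img_mono ?_)
    rintro ⟨x, r⟩ ((hx | ⟨h1, h2, h3⟩) | hx)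
    · exact Or.inl hx
    · exact Or.inr ⟨h1, h2, by simp only at h3 ⊢; omega⟩
    · obtain ⟨rfl, rfl⟩ := Prod.mk.inj hx
      exact Or.inr ⟨rfl, by simp only; omega, le_rfl⟩

lemma pathOn_tail {q : ZMod c} {s t : ℕ} (hst : s ≤ t) (ht : t ≤ T.e q) :
    PathOn H (T.img {x | x.1 = q ∧ s ≤ x.2 ∧ x.2 ≤ t}) (T.y q s) (T.y q t) (1 + (t - s)) := by
  refine (T.climb (S := {(q, s)}) (PathOn.single ⟨_, rfl, by simp only; omega, rfl⟩) hst ht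
    ?_).mono (T.img_mono ?_)
  · rintro r hr hx
    have := (Prod.mk.inj hx).2
    omega
  · rintro ⟨x, r⟩ (hx | hx)
    · obtain ⟨rfl, rfl⟩ := Prod.mk.inj hx
      exact ⟨rfl, le_rfl, hst⟩
    · exact hx

lemma pathOn_arc (p : ZMod c) {m : ℕ} (hm : m < c) :
    PathOn H (T.img {x | x.1 ∈ cyclicArc p m ∧ x.2 = 0}) (T.y p 0) (T.y (p + (m : ℕ)) 0)
      (m + 1) := by
  refine (T.isRing.pathOn p hm).mono ?_
  rintro _ ⟨x, hx, rfl⟩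
  exact ⟨(x, 0), ⟨hx, rfl⟩, Nat.zero_le _, rfl⟩

lemma pathOn_ribbon (p : ZMod c) {m s t : ℕ} (h1 : 1 ≤ m) (hm : m < c) (hs : s ≤ T.e p)
    (ht : t ≤ T.e (p + (m : ℕ))) :
    PathOn H (T.img (ribbon p m s t)) (T.y p s) (T.y (p + (m : ℕ)) t) (m + 1 + s + t) := by
  have hne : p ≠ p + (m : ℕ) := fun h => by
    have := add_natCast_zmod_inj (p := p) (a := 0) (b := m) (by omega) hm (by simpa using h)
    omega
  have a1 := (T.climb (T.pathOn_arc p hm) (Nat.zero_le t) ht (fun r hr hx => by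
    have := hx.2; simp only at this; omega)).symm
  have a2 := (T.climb a1 (Nat.zero_le s) hs (fun r hr hx => by
    rcases hx with hx | hx
    · have := hx.2; simp only at this; omega
    · exact hne hx.1)).symm
  rw [show m + 1 + (t - 0) + (s - 0) = m + 1 + s + t by omega] at a2
  refine a2.mono (T.img_mono ?_)
  rintro ⟨x, r⟩ ((⟨h, h'⟩ | ⟨h, -, h'⟩) | ⟨h, -, h'⟩)
  · exact ⟨h, Or.inl h'⟩
  · exact ⟨⟨m, le_rfl, h⟩, Or.inr (Or.inr ⟨h, h'⟩)⟩
  · exact ⟨⟨0, Nat.zero_le _, by simpa using h⟩, Or.inr (Or.inl ⟨h, h'⟩)⟩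

lemma disjoint_of_fst {S S' : Set (ZMod c × ℕ)} {A A' : Set (ZMod c)} (h : Disjoint A A')
    (hS : ∀ x ∈ S, x.1 ∈ A) (hS' : ∀ x ∈ S', x.1 ∈ A') : Disjoint S S' :=
  Set.disjoint_left.2 fun x hx hx' => Set.disjoint_left.1 h (hS x hx) (hS' x hx')

variable {T}

/-- Heights of two adjacent vertices on different tails. -/
lemma add_le_of_adj (hc : CircumferenceLE H c) {p : ZMod c} {m s t : ℕ} (h1 : 1 ≤ m)
    (hm : m < c) (hs : s ≤ T.e p) (ht : t ≤ T.e (p + (m : ℕ)))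
    (h : H.Adj (T.y p s) (T.y (p + (m : ℕ)) t)) :
    m + 1 + s + t ≤ c ∧ (c - m) + 1 + s + t ≤ c := by
  refine ⟨hc _ _ _ _ (T.pathOn_ribbon p h1 hm hs ht) h.symm, ?_⟩
  have e := add_natCast_sub p hm.le
  have := T.pathOn_ribbon (p + (m : ℕ)) (m := c - m) (s := t) (t := s) (by omega) (by omega) ht
    (by rwa [e])
  rw [e] at this
  have := hc _ _ _ _ this h
  omega

/-- A vertex at positive height adjacent to two other tails. -/
lemma add_le_of_adj_adj (hc : CircumferenceLE H c) {i p : ZMod c} {m s t r : ℕ} (h1 : 1 ≤ m)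
    (hm : m < c) (hs : s ≤ T.e p) (ht : t ≤ T.e (p + (m : ℕ))) (hr : 1 ≤ r) (hri : r ≤ T.e i)
    (hp : i ≠ p) (hp' : i ≠ p + (m : ℕ))
    (h : H.Adj (T.y i r) (T.y p s)) (h' : H.Adj (T.y i r) (T.y (p + (m : ℕ)) t)) :
    m + 1 + s + t + 1 ≤ c := by
  refine hc _ _ _ _ ((T.pathOn_ribbon p h1 hm hs ht).trans h'.symm
    (PathOn.single (S := T.img {(i, r)}) ⟨_, rfl, hri, rfl⟩) (T.disjoint_img ?_)) h
  rw [Set.disjoint_singleton_right]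
  rintro ⟨-, hx | hx | hx⟩
  · simp only at hx; omega
  · exact hp hx.1
  · exact hp' hx.1

end TailSystem

namespace TailSystem

variable {W : Type*} {H : SimpleGraph W} {c : ℕ}

/-- Lengthen the tail at `i` by a new vertex `z`. -/
def extend (T : TailSystem H c) (i : ZMod c) (z : W) (hz : H.Adj (T.tip i) z)
    (hnew : ∀ j t, t ≤ T.e j → z ≠ T.y j t) : TailSystem H c where
  e := Function.update T.e i (T.e i + 1)
  y := fun j s => if j = i ∧ s = T.e i + 1 then z else T.y j s
  inj := by
    have key : ∀ j s, s ≤ Function.update T.e i (T.e i + 1) j →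
        ¬ (j = i ∧ s = T.e i + 1) → s ≤ T.e j := by
      intro j s hs hn
      by_cases hj : j = i
      · subst hj
        rw [Function.update_self] at hs
        have : s ≠ T.e j + 1 := fun h => hn ⟨rfl, h⟩
        omega
      · rwa [Function.update_of_ne hj] at hs
    intro j k s t hs ht h
    split_ifs at h with h1 h2 h2
    · exact ⟨h1.1.trans h2.1.symm, h1.2.trans h2.2.symm⟩
    · exact absurd h (hnew _ _ (key _ _ ht h2))
    · exact absurd h.symm (hnew _ _ (key _ _ hs h1))
    · exact T.inj _ _ _ _ (key _ _ hs h1) (key _ _ ht h2) h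
  adj_tail := by
    intro j s hs
    by_cases hj : j = i
    · subst hj
      rw [Function.update_self] at hs
      rw [if_neg (by omega)]
      by_cases he : s = T.e j
      · rw [if_pos ⟨rfl, by omega⟩, he]; exact hz
      · rw [if_neg (by omega)]; exact T.adj_tail j s (by omega)
    · rw [Function.update_of_ne hj] at hs
      rw [if_neg (by tauto), if_neg (by tauto)]
      exact T.adj_tail j s hs
  adj_ring := by
    intro h j
    rw [if_neg (by omega), if_neg (by omega)]
    exact T.adj_ring h j

/-- Cut the tail at `k` below height `t` and attach the upper part to the bare vertex at `i`. -/
def move (T : TailSystem H c) (i k : ZMod c) (t : ℕ) (hi : T.e i = 0) (hki : k ≠ i) (ht : 1 ≤ t)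
    (htk : t ≤ T.e k) (hadj : H.Adj (T.y i 0) (T.y k t)) : TailSystem H c where
  e := Function.update (Function.update T.e k (t - 1)) i (T.e k - t + 1)
  y := fun j s => if j = i ∧ 1 ≤ s then T.y k (t - 1 + s) else T.y j s
  inj := by
    set e' := Function.update (Function.update T.e k (t - 1)) i (T.e k - t + 1) with he'
    have ei : e' i = T.e k - t + 1 := by rw [he', Function.update_self]
    have ek : e' k = t - 1 := by rw [he', Function.update_of_ne hki, Function.update_self]
    have eo : ∀ j, j ≠ i → j ≠ k → e' j = T.e j := fun j h1 h2 => by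
      rw [he', Function.update_of_ne h1, Function.update_of_ne h2]
    have key : ∀ j s, s ≤ e' j → ¬ (j = i ∧ 1 ≤ s) → s ≤ T.e j ∧ (j = k → s ≤ t - 1) := by
      intro j s hs hn
      by_cases hj : j = i
      · subst hj
        have : ¬ 1 ≤ s := fun h => hn ⟨rfl, h⟩
        exact ⟨by omega, fun h => absurd h.symm hki⟩
      · by_cases hjk : j = k
        · subst hjk
          exact ⟨by omega, fun _ => by omega⟩
        · exact ⟨by rwa [eo j hj hjk] at hs, fun h => absurd h hjk⟩
    intro j l s r hs hr h
    split_ifs at h with h1 h2 h2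
    · obtain ⟨rfl, h1⟩ := h1
      obtain ⟨rfl, h2⟩ := h2
      have := (T.inj _ _ _ _ (by omega) (by omega) h).2
      exact ⟨rfl, by omega⟩
    · obtain ⟨rfl, h1⟩ := h1
      obtain ⟨hr1, hr2⟩ := key _ _ hr h2
      obtain ⟨h3, h4⟩ := T.inj _ _ _ _ (by omega) hr1 h
      have := hr2 h3.symm
      omega
    · obtain ⟨rfl, h2⟩ := h2
      obtain ⟨hr1, hr2⟩ := key _ _ hs h1
      obtain ⟨h3, h4⟩ := T.inj _ _ _ _ hr1 (by omega) h
      have := hr2 h3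
      omega
    · exact T.inj _ _ _ _ (key _ _ hs h1).1 (key _ _ hr h2).1 h
  adj_tail := by
    intro j s hs
    by_cases hj : j = i
    · subst hj
      rw [Function.update_self] at hs
      by_cases h0 : s = 0
      · subst h0
        rw [if_neg (by omega), if_pos ⟨rfl, by omega⟩, show t - 1 + (0 + 1) = t by omega]
        exact hadj
      · rw [if_pos (⟨rfl, by omega⟩ : j = j ∧ 1 ≤ s),
          if_pos (⟨rfl, by omega⟩ : j = j ∧ 1 ≤ s + 1)]
        exact T.adj_tail k _ (by omega)
    · rw [Function.update_of_ne hj] at hs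
      rw [if_neg (by tauto), if_neg (by tauto)]
      refine T.adj_tail j s ?_
      by_cases hjk : j = k
      · subst hjk
        rw [Function.update_self] at hs
        omega
      · rwa [Function.update_of_ne hjk] at hs
  adj_ring := by
    intro h j
    rw [if_neg (by omega), if_neg (by omega)]
    exact T.adj_ring h j

section extend

variable (T : TailSystem H c) (i : ZMod c) (z : W) (hz : H.Adj (T.tip i) z)
  (hnew : ∀ j t, t ≤ T.e j → z ≠ T.y j t)

lemma extend_e_self : (T.extend i z hz hnew).e i = T.e i + 1 := Function.update_self ..

lemma extend_e_of_ne {j : ZMod c} (hj : j ≠ i) : (T.extend i z hz hnew).e j = T.e j :=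
  Function.update_of_ne hj ..

end extend

section move

variable (T : TailSystem H c) (i k : ZMod c) (t : ℕ) (hi : T.e i = 0) (hki : k ≠ i) (ht : 1 ≤ t)
  (htk : t ≤ T.e k) (hadj : H.Adj (T.y i 0) (T.y k t))

lemma move_e_self : (T.move i k t hi hki ht htk hadj).e i = T.e k - t + 1 :=
  Function.update_self ..

lemma move_e_source : (T.move i k t hi hki ht htk hadj).e k = t - 1 :=
  (Function.update_of_ne hki ..).trans (Function.update_self ..)

lemma move_e_of_ne {j : ZMod c} (hji : j ≠ i) (hjk : j ≠ k) :
    (T.move i k t hi hki ht htk hadj).e j = T.e j :=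
  (Function.update_of_ne hji ..).trans (Function.update_of_ne hjk ..)

lemma move_y_of_ne {j : ZMod c} (hji : j ≠ i) (s : ℕ) :
    (T.move i k t hi hki ht htk hadj).y j s = T.y j s :=
  if_neg fun h => hji h.1

end move

variable [NeZero c]

/-- The total height of the tails plus the number of nontrivial tails. -/
def potential (T : TailSystem H c) : ℕ := ∑ i, (T.e i + if T.e i = 0 then 0 else 1)

lemma potential_extend (T : TailSystem H c) (i : ZMod c) (z : W) (hz : H.Adj (T.tip i) z)
    (hnew : ∀ j t, t ≤ T.e j → z ≠ T.y j t) :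
    T.potential < (T.extend i z hz hnew).potential := by
  refine Finset.sum_lt_sum (fun j _ => ?_) ⟨i, Finset.mem_univ _, ?_⟩
  · by_cases hj : j = i
    · subst hj
      rw [extend_e_self]
      split_ifs <;> omega
    · rw [extend_e_of_ne _ _ _ _ _ hj]
  · rw [extend_e_self, if_neg (Nat.succ_ne_zero _)]
    split_ifs <;> omega

lemma potential_move (T : TailSystem H c) (i k : ZMod c) (t : ℕ) (hi : T.e i = 0) (hki : k ≠ i)
    (ht : 1 ≤ t) (htk : t ≤ T.e k) (hadj : H.Adj (T.y i 0) (T.y k t)) :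
    (T.move i k t hi hki ht htk hadj).potential = T.potential + if t = 1 then 0 else 1 := by
  have split : ∀ f : ZMod c → ℕ,
      ∑ j, f j = f i + (f k + ∑ j ∈ (Finset.univ.erase i).erase k, f j) := fun f => by
    rw [Finset.add_sum_erase _ _ (by simp [hki]), Finset.add_sum_erase _ _ (by simp)]
  unfold potential
  rw [split, split]
  have : ∑ j ∈ (Finset.univ.erase i).erase k, ((T.move i k t hi hki ht htk hadj).e j +
      if (T.move i k t hi hki ht htk hadj).e j = 0 then 0 else 1) =
      ∑ j ∈ (Finset.univ.erase i).erase k, (T.e j + if T.e j = 0 then 0 else 1) := by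
    refine Finset.sum_congr rfl fun j hj => ?_
    simp only [Finset.mem_erase] at hj
    rw [move_e_of_ne _ _ _ _ _ _ _ _ _ hj.2.1 hj.1]
  rw [this, move_e_self, move_e_source, hi, if_neg (Nat.succ_ne_zero _),
    if_pos rfl, if_neg (show T.e k ≠ 0 by omega)]
  by_cases h1 : t = 1
  · rw [if_pos (by omega), if_pos h1]
    omega
  · rw [if_neg (by omega), if_neg h1]
    omega

lemma potential_le [Fintype W] (T : TailSystem H c) : T.potential ≤ 2 * Fintype.card W := by
  have h1 : ∑ i, (T.e i + 1) ≤ Fintype.card W := by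
    have := Fintype.card_le_of_injective
      (fun x : (Σ i : ZMod c, Fin (T.e i + 1)) => T.y x.1 x.2) (by
        rintro ⟨i, s⟩ ⟨j, t⟩ h
        obtain ⟨rfl, h2⟩ := T.inj _ _ _ _ (Nat.lt_succ_iff.1 s.2) (Nat.lt_succ_iff.1 t.2) h
        rw [Fin.ext h2])
    simpa [Fintype.card_sigma] using this
  refine le_trans ?_ (Nat.mul_le_mul_left 2 h1)
  rw [Finset.mul_sum]
  refine Finset.sum_le_sum fun i _ => ?_
  split_ifs <;> omega

/-- No tail can be lengthened, and a bare ring vertex is not adjacent to other tails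
above their first vertices. -/
def Saturated (T : TailSystem H c) : Prop :=
  (∀ i z, H.Adj (T.tip i) z → ∃ j t, t ≤ T.e j ∧ z = T.y j t) ∧
    ∀ i k t, T.e i = 0 → k ≠ i → t ≤ T.e k → H.Adj (T.y i 0) (T.y k t) → t ≤ 1

lemma saturated_of_forall_le {T : TailSystem H c}
    (h : ∀ T' : TailSystem H c, T'.potential ≤ T.potential) : T.Saturated := by
  refine ⟨fun i z hz => ?_, fun i k t hi hki htk hadj => ?_⟩
  · by_contra! hnew
    exact absurd (h _) (not_le.2 (T.potential_extend i z hz hnew))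
  · by_contra! ht
    have := h (T.move i k t hi hki (by omega) htk hadj)
    rw [potential_move, if_neg (by omega)] at this
    omega

lemma exists_max_potential [Fintype W] (T₀ : TailSystem H c) :
    ∃ T : TailSystem H c, ∀ T' : TailSystem H c, T'.potential ≤ T.potential := by
  have hne : (Set.range (potential : TailSystem H c → ℕ)).Nonempty := ⟨_, T₀, rfl⟩
  have hbdd : BddAbove (Set.range (potential : TailSystem H c → ℕ)) :=
    ⟨2 * Fintype.card W, by rintro _ ⟨T, rfl⟩; exact T.potential_le⟩
  obtain ⟨T, hT⟩ := Nat.sSup_mem hne hbdd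
  exact ⟨T, fun T' => hT ▸ le_csSup hbdd ⟨T', rfl⟩⟩

end TailSystem

/-- Going from the position `i + r'` to the earlier position `i + r` around the ring. -/
lemma add_natCast_add_natCast_sub {n : ℕ} (i : ZMod n) {r r' : ℕ} (h : r ≤ r')
    (h' : r' - r ≤ n) :
    i + (r' : ZMod n) + ((n - (r' - r) : ℕ) : ZMod n) = i + (r : ℕ) := by
  have := add_natCast_sub (i + (r : ZMod n)) h'
  rwa [add_assoc i, ← Nat.cast_add, Nat.add_sub_cancel' h] at this

namespace TailSystem

variable {W : Type*} {H : SimpleGraph W} {c : ℕ} {T : TailSystem H c}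

lemma false_of_adj_tip_of_lt (hc : CircumferenceLE H c) {i : ZMod c} (hi : 1 ≤ T.e i)
    {r r' t t' : ℕ} (hr : r < r') (hr' : r' < c) (ht : t ≤ T.e (i + (r : ℕ)))
    (ht' : t' ≤ T.e (i + (r' : ℕ))) (h : H.Adj (T.tip i) (T.y (i + (r : ℕ)) t))
    (h' : H.Adj (T.tip i) (T.y (i + (r' : ℕ)) t')) (heq : r + t = r' + t') : False := by
  rcases Nat.eq_zero_or_pos r with rfl | hr0
  · have := (add_le_of_adj hc (by omega) hr' le_rfl ht' h').2
    rw [Nat.cast_zero, add_zero] at ht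
    omega
  · have hback := add_natCast_add_natCast_sub i hr.le (by omega : r' - r ≤ c)
    have hne : ∀ q : ℕ, 1 ≤ q → q < c → i ≠ i + (q : ℕ) := fun q h1 h2 h3 => by
      have := add_natCast_zmod_inj (p := i) (a := 0) (b := q) (by omega) h2 (by simpa using h3)
      omega
    have := add_le_of_adj_adj hc (p := i + (r' : ℕ)) (m := c - (r' - r)) (s := t') (t := t)
      (by omega) (by omega) ht' (by rwa [hback]) hi le_rfl (hne _ (by omega) hr')
      (by rw [hback]; exact hne _ hr0 (by omega)) h' (by rwa [hback])
    omega

/-- The end of a nontrivial tail has fewer than `c` neighbours. -/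
lemma ncard_tip_lt [NeZero c] (hc : CircumferenceLE H c) (hT : T.Saturated) {i : ZMod c}
    (hi : 1 ≤ T.e i) : (H.neighborSet (T.tip i)).ncard + 1 ≤ c := by
  have hc0 : 0 < c := NeZero.pos c
  choose! J t ht hz using hT.1 i
  have own : ∀ z, H.Adj (T.tip i) z → J z = i → t z < T.e i ∧ 1 + (T.e i - t z) ≤ c := by
    intro z hz' hJ
    have h1 := ht z hz'
    have h2 := hz z hz'
    rw [hJ] at h1 h2
    rw [h2] at hz'
    refine ⟨lt_of_le_of_ne h1 fun h => ?_, hc _ _ _ _ (T.pathOn_tail h1 le_rfl) hz'⟩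
    rw [h] at hz'
    exact H.irrefl hz'
  by_cases hall : ∀ z, H.Adj (T.tip i) z → J z = i
  · have := Set.ncard_le_ncard_of_injOn (s := H.neighborSet (T.tip i))
      (t := (Finset.Ico (T.e i + 1 - c) (T.e i) : Finset ℕ)) t
      (fun z hz' => by
        have := own z hz' (hall z hz')
        simp only [Finset.coe_Ico, Set.mem_Ico]
        omega)
      (fun z hz' z' hz'' h => by
        rw [hz z hz', hz z' hz'', hall z hz', hall z' hz'', h])
      (Finset.finite_toSet _)
    rw [Set.ncard_coe_finset, Nat.card_Ico] at this
    omega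
  · push Not at hall
    obtain ⟨z₀, hz₀, hJ₀⟩ := hall
    have pos : ∀ z, ∃ r : ℕ, r < c ∧ J z = i + (r : ℕ) ∧ (J z - i).val = r := fun z => by
      obtain ⟨r, hr, h⟩ := exists_eq_add_natCast i (J z)
      exact ⟨r, hr, h, by rw [h, add_sub_cancel_left, ZMod.val_natCast_of_lt hr]⟩
    have away : ∀ z, H.Adj (T.tip i) z → ∀ r, 1 ≤ r → r < c → J z = i + (r : ℕ) →
        r + 1 + T.e i + t z ≤ c := by
      intro z hz' r h1 hr h
      have h3 := ht z hz'
      have h4 := hz z hz'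
      rw [h] at h3 h4
      rw [h4] at hz'
      exact (add_le_of_adj hc h1 hr le_rfl h3 hz').1
    have hei : T.e i + 2 ≤ c := by
      obtain ⟨r, h1, hr, h⟩ := exists_eq_add_natCast_pos hJ₀
      have := away z₀ hz₀ r h1 hr h
      omega
    have := Set.ncard_le_ncard_of_injOn (s := H.neighborSet (T.tip i))
      (t := (Finset.range (c - 1) : Finset ℕ)) (fun z => (J z - i).val + t z)
      (fun z hz' => by
        obtain ⟨r, hr, h, hv⟩ := pos z
        rw [hv, Finset.mem_coe, Finset.mem_range]
        rcases Nat.eq_zero_or_pos r with rfl | hr0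
        · have := own z hz' (by simpa using h)
          omega
        · have := away z hz' r hr0 hr h
          omega)
      (fun z hz' z' hz'' h => by
        obtain ⟨r, hr, h1, hv⟩ := pos z
        obtain ⟨r', hr', h1', hv'⟩ := pos z'
        simp only [hv, hv'] at h
        have a1 := ht z hz'
        have a2 := hz z hz'
        have b1 := ht z' hz''
        have b2 := hz z' hz''
        rw [h1] at a1 a2
        rw [h1'] at b1 b2
        rw [mem_neighborSet, a2] at hz'
        rw [mem_neighborSet, b2] at hz''
        rcases lt_trichotomy r r' with hlt | heq | hlt
        · exact (false_of_adj_tip_of_lt hc hi hlt hr' a1 b1 hz' hz'' h).elim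
        · subst heq
          rw [a2, b2, show t z = t z' by omega]
        · exact (false_of_adj_tip_of_lt hc hi hlt hr b1 a1 hz'' hz' h.symm).elim)
      (Finset.finite_toSet _)
    rw [Set.ncard_coe_finset, Finset.card_range] at this
    omega

end TailSystem

namespace TailSystem

variable {W : Type*} {H : SimpleGraph W} {c : ℕ} {T : TailSystem H c}

variable (T) in
/-- A bare ring vertex with at least `c` neighbours. -/
def Bad (i : ZMod c) : Prop := T.e i = 0 ∧ c ≤ (H.neighborSet (T.y i 0)).ncard

variable (T) in
/-- The positions of the tails whose first vertex is adjacent to the ring vertex at `i`. -/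
def links (i : ZMod c) : Set (ZMod c) := {k | k ≠ i ∧ 1 ≤ T.e k ∧ H.Adj (T.y i 0) (T.y k 1)}

variable (T) in
/-- The positions of the ring vertices adjacent to the ring vertex at `i`. -/
def chords (i : ZMod c) : Set (ZMod c) := {k | H.Adj (T.y i 0) (T.y k 0)}

lemma ncard_tip_lt_of_not_bad [NeZero c] (hc : CircumferenceLE H c) (hT : T.Saturated) {i : ZMod c}
    (hi : ¬ T.Bad i) : (H.neighborSet (T.tip i)).ncard + 1 ≤ c := by
  rcases Nat.eq_zero_or_pos (T.e i) with h | h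
  · by_contra! hlt
    exact hi ⟨h, by rw [tip, h] at hlt; omega⟩
  · exact ncard_tip_lt hc hT h

lemma ncard_neighborSet_le [NeZero c] (hT : T.Saturated) {i : ZMod c} (hi : T.e i = 0) :
    (H.neighborSet (T.y i 0)).ncard ≤ (T.chords i).ncard + (T.links i).ncard := by
  have hsub : H.neighborSet (T.y i 0) ⊆
      (fun k => T.y k 0) '' T.chords i ∪ (fun k => T.y k 1) '' T.links i := by
    intro z hz
    obtain ⟨j, t, ht, rfl⟩ := hT.1 i z (by rwa [tip, hi])
    rw [mem_neighborSet] at hz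
    by_cases hj : j = i
    · subst hj
      rw [show t = 0 by omega] at hz
      exact (H.irrefl hz).elim
    · have := hT.2 i j t hi hj ht hz
      interval_cases t
      · exact Or.inl ⟨j, hz, rfl⟩
      · exact Or.inr ⟨j, ⟨hj, ht, hz⟩, rfl⟩
  calc _ ≤ _ := Set.ncard_le_ncard hsub (Set.toFinite _)
    _ ≤ _ := Set.ncard_union_le _ _
    _ ≤ _ := Nat.add_le_add (Set.ncard_image_le (Set.toFinite _))
        (Set.ncard_image_le (Set.toFinite _))

lemma notMem_chords (i : ZMod c) : i ∉ T.chords i := fun h => H.irrefl h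

lemma Bad.links_nonempty [NeZero c] (hT : T.Saturated) {i : ZMod c} (hi : T.Bad i) :
    (T.links i).Nonempty := by
  by_contra! h
  have h1 := ncard_neighborSet_le hT hi.1
  rw [h, Set.ncard_empty] at h1
  have h2 := Set.ncard_le_ncard (Set.subset_univ (insert i (T.chords i)))
  rw [Set.ncard_insert_of_notMem (notMem_chords i), Set.ncard_univ, Nat.card_zmod] at h2
  have := hi.2
  omega

lemma exists_of_mem_links (hc : CircumferenceLE H c) [NeZero c] {i k : ZMod c}
    (hk : k ∈ T.links i) : ∃ m : ℕ, 2 ≤ m ∧ m + 2 ≤ c ∧ k = i + (m : ℕ) := by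
  obtain ⟨m, h1, hm, rfl⟩ := exists_eq_add_natCast_pos hk.1
  have := add_le_of_adj hc h1 hm (Nat.zero_le _) hk.2.1 hk.2.2
  exact ⟨m, by omega, by omega, rfl⟩

lemma not_adj_of_adj_first (hc : CircumferenceLE H c) {p : ZMod c} {m : ℕ} (h1 : 1 ≤ m)
    (hm : m < c) (he : 1 ≤ T.e (p + (m : ℕ))) (h : H.Adj (T.y p 0) (T.y (p + (m : ℕ)) 1)) :
    ¬ H.Adj (T.y (p - 1) 0) (T.y (p + (m : ℕ) - 1) 0) := by
  intro h'
  have e1 : p + ((m - 1 : ℕ) : ZMod c) = p + (m : ℕ) - 1 := by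
    rw [Nat.cast_pred h1]; ring
  have e2 : p + (m : ℕ) + ((c - 1 - m : ℕ) : ZMod c) = p - 1 := by
    have : ((m + (c - 1 - m) + 1 : ℕ) : ZMod c) = 0 := by
      rw [show m + (c - 1 - m) + 1 = c by omega, ZMod.natCast_self]
    push_cast at this
    linear_combination this
  have a1 := (T.pathOn_arc p (m := m - 1) (by omega)).symm
  have a2 := T.pathOn_arc (p + (m : ℕ)) (m := c - 1 - m) (by omega)
  rw [e1] at a1
  rw [e2] at a2
  have := (a1.trans h (PathOn.single (S := T.img {(p + (m : ℕ), 1)}) ⟨_, rfl, he, rfl⟩)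
    (T.disjoint_img ?_)).trans (T.adj_tail _ 0 he).symm a2 ?_
  · have := hc _ _ _ _ this h'
    omega
  · rw [Set.disjoint_singleton_right]
    rintro ⟨-, hx⟩
    simp at hx
  · rw [T.img_union]
    refine T.disjoint_img (Set.disjoint_union_left.2 ⟨disjoint_of_fst
      (cyclicArc_disjoint (p := p) (m := m - 1) (q := m) (m' := c - 1 - m) (by omega) (by omega))
      (fun x hx => hx.1) (fun x hx => hx.1), ?_⟩)
    rw [Set.disjoint_singleton_left]
    rintro ⟨-, hx⟩
    simp at hx

lemma not_adj_of_adj_last (hc : CircumferenceLE H c) {p : ZMod c} {m : ℕ} (hm : m + 2 ≤ c)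
    (he : 1 ≤ T.e (p + (m : ℕ))) (h : H.Adj (T.y (p - 1) 0) (T.y (p + (m : ℕ)) 1)) :
    ¬ H.Adj (T.y p 0) (T.y (p + (m : ℕ) + 1) 0) := by
  intro h'
  have e1 : p + ((m + 1 : ℕ) : ZMod c) = p + (m : ℕ) + 1 := by push_cast; ring
  have e2 : p + ((m + 1 : ℕ) : ZMod c) + ((c - 2 - m : ℕ) : ZMod c) = p - 1 := by
    have : ((m + 1 + (c - 2 - m) + 1 : ℕ) : ZMod c) = 0 := by
      rw [show m + 1 + (c - 2 - m) + 1 = c by omega, ZMod.natCast_self]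
    push_cast at this ⊢
    linear_combination this
  have a1 := (T.pathOn_arc p (m := m) (by omega)).symm
  have a2 := T.pathOn_arc (p + ((m + 1 : ℕ) : ZMod c)) (m := c - 2 - m) (by omega)
  rw [e2] at a2
  rw [← e1] at h'
  have := (a2.trans h (PathOn.single (S := T.img {(p + (m : ℕ), 1)}) ⟨_, rfl, he, rfl⟩)
    (T.disjoint_img ?_)).trans (T.adj_tail _ 0 he).symm a1 ?_
  · have := hc _ _ _ _ this h'
    omega
  · rw [Set.disjoint_singleton_right]
    rintro ⟨-, hx⟩
    simp at hx
  · rw [T.img_union]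
    refine T.disjoint_img (Set.disjoint_union_left.2 ⟨(disjoint_of_fst
      (cyclicArc_disjoint (p := p) (m := m) (q := m + 1) (m' := c - 2 - m) (by omega) (by omega))
      (fun x hx => hx.1) (fun x hx => hx.1)).symm, ?_⟩)
    rw [Set.disjoint_singleton_left]
    rintro ⟨-, hx⟩
    simp at hx

/-- Consecutive ring vertices are not both bad. -/
lemma Bad.not_bad_add_one [NeZero c] (hc : CircumferenceLE H c) (hT : T.Saturated) {i : ZMod c}
    (hi : T.Bad i) : ¬ T.Bad (i + 1) := by
  intro hi'
  have count : ∀ (j : ZMod c) (f : ZMod c → ZMod c) (L : Set (ZMod c)), Function.Injective f →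
      (∀ k ∈ L, f k ≠ j ∧ f k ∉ T.chords j) → (T.chords j).ncard + L.ncard + 1 ≤ c := by
    intro j f L hf hL
    have h2 := Set.ncard_le_ncard (Set.subset_univ (insert j (T.chords j ∪ f '' L)))
    rw [Set.ncard_insert_of_notMem, Set.ncard_union_eq, Set.ncard_image_of_injective _ hf,
      Set.ncard_univ, Nat.card_zmod] at h2
    · exact h2
    · rw [Set.disjoint_right]
      rintro _ ⟨k, hk, rfl⟩
      exact (hL k hk).2
    · rintro (h | ⟨k, hk, h⟩)
      · exact notMem_chords j h
      · exact (hL k hk).1 h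
  have c1 := count i (fun k => k - 1) (T.links (i + 1)) (sub_left_injective) (fun k hk => by
    refine ⟨fun h => hk.1 (by rw [← h]; ring), fun h => ?_⟩
    obtain ⟨m, h1, h2, rfl⟩ := exists_of_mem_links hc hk
    refine not_adj_of_adj_first hc (by omega) (by omega) hk.2.1 hk.2.2 ?_
    rwa [add_sub_cancel_right])
  have c2 := count (i + 1) (fun k => k + 1) (T.links i) (add_left_injective 1) (fun k hk => by
    refine ⟨fun h => hk.1 (add_right_cancel h), fun h => ?_⟩
    obtain ⟨m, h1, h2, rfl⟩ := exists_of_mem_links hc hk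
    have e : i + (m : ZMod c) = i + 1 + ((m - 1 : ℕ) : ZMod c) := by
      rw [Nat.cast_pred (by omega)]; ring
    have h3 := hk.2
    rw [e] at h3 h
    refine not_adj_of_adj_last hc (by omega) h3.1 ?_ h
    rw [add_sub_cancel_right]
    exact h3.2)
  have n1 := ncard_neighborSet_le hT hi.1
  have n2 := ncard_neighborSet_le hT hi'.1
  have := hi.2
  have := hi'.2
  omega

/-- Some extremal system has two consecutive ring vertices that are not bad. -/
lemma exists_saturated_not_bad [NeZero c] [Fintype W] (hc : CircumferenceLE H c)
    (T₀ : TailSystem H c) :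
    ∃ (T : TailSystem H c) (k : ZMod c), T.Saturated ∧ ¬ T.Bad (k - 1) ∧ ¬ T.Bad k := by
  obtain ⟨T, hT⟩ := exists_max_potential T₀
  have hsat := saturated_of_forall_le hT
  by_cases hb : ∃ b, T.Bad b
  · obtain ⟨b, hb⟩ := hb
    obtain ⟨k, hk⟩ := hb.links_nonempty hsat
    obtain ⟨m, h1, h2, hm⟩ := exists_of_mem_links hc hk
    have hnext := hb.not_bad_add_one hc hsat
    have hb1 : b + 1 ≠ b := fun h => by
      have := add_natCast_zmod_inj (p := b) (a := 1) (b := 0) (by omega) (by omega)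
        (by simpa using h)
      omega
    have hbk : b + 1 ≠ k := fun h => by
      have := add_natCast_zmod_inj (p := b) (a := 1) (b := m) (by omega) (by omega)
        (by rw [← hm, ← h, Nat.cast_one])
      omega
    refine ⟨T.move b k 1 hb.1 hk.1 le_rfl hk.2.1 hk.2.2, b + 1,
      saturated_of_forall_le fun T' => ?_, ?_, ?_⟩
    · rw [potential_move, if_pos rfl]
      exact hT T'
    · rintro ⟨h, -⟩
      rw [add_sub_cancel_right, move_e_self] at h
      omega
    · rintro ⟨h3, h4⟩
      rw [move_e_of_ne _ _ _ _ _ _ _ _ _ hb1 hbk] at h3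
      rw [move_y_of_ne _ _ _ _ _ _ _ _ _ hb1] at h4
      exact hnext ⟨h3, h4⟩
  · push Not at hb
    exact ⟨T, 0, hsat, hb _, hb _⟩

end TailSystem

lemma sum_zmod_eq_sum_range {n : ℕ} [NeZero n] (j : ZMod n) (F : ZMod n → ℕ) :
    ∑ i, F i = ∑ r ∈ Finset.range n, F (j + (r : ℕ)) := by
  symm
  refine Finset.sum_bij (fun r _ => j + (r : ZMod n)) (fun _ _ => Finset.mem_univ _)
    (fun r hr s hs h => add_natCast_zmod_inj (Finset.mem_range.1 hr) (Finset.mem_range.1 hs) h)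
    (fun i _ => ?_) (fun _ _ => rfl)
  obtain ⟨r, hr, rfl⟩ := exists_eq_add_natCast j i
  exact ⟨r, Finset.mem_range.2 hr, rfl⟩

/-- Counting the elements of `a` in an initial segment, with an extra unit for each element
preceded by an element of `b`, where `b` is disjoint from `a` and has no two consecutive
elements. -/
lemma sum_range_add_le {a b : ℕ → Prop} [DecidablePred a] [DecidablePred b] (h0 : ¬ b 0) (hb : ∀ r, b r → ¬ b (r + 1))
    (ha : ∀ r, a r → ¬ b r) (L : ℕ) :
    ∑ r ∈ Finset.range L, (if a (r + 1) then 1 + (if b r then 1 else 0) else 0) +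
      (if b L then 1 else 0) +
      ∑ r ∈ Finset.range L, (if ¬ b (r + 1) ∧ ¬ a (r + 1) then 1 else 0) ≤ L := by
  induction L with
  | zero => simp [h0]
  | succ L ih =>
    rw [Finset.sum_range_succ, Finset.sum_range_succ]
    have h1 := hb L
    have h2 := ha (L + 1)
    by_cases hbL : b L <;> by_cases hbL' : b (L + 1) <;> by_cases haL : a (L + 1) <;>
      simp only [hbL, hbL', haL, if_true, if_false, not_true, not_false_eq_true, and_true,
        and_false, imp_false, true_implies] at ih h1 h2 ⊢ <;> omega

namespace TailSystem

variable {W : Type*} {H : SimpleGraph W} {c : ℕ} {T : TailSystem H c}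

variable (T) in
open scoped Classical in
/-- A ring vertex that is not bad has weight one, plus one if it follows a bad vertex, plus one
if it is the distinguished vertex `k₀`. -/
noncomputable def weight (k₀ k : ZMod c) : ℕ :=
  (if T.Bad k then 0 else 1) + (if T.Bad (k - 1) then 1 else 0) + (if k = k₀ then 1 else 0)

lemma not_bad_of_weight_ne_zero [NeZero c] (hc : CircumferenceLE H c) (hT : T.Saturated)
    {k₀ k : ZMod c} (h₀ : ¬ T.Bad k₀) (h : T.weight k₀ k ≠ 0) : ¬ T.Bad k := by
  intro hk
  apply h
  have h1 : ¬ T.Bad (k - 1) := fun h1 => by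
    have := h1.not_bad_add_one hc hT
    rw [sub_add_cancel] at this
    exact this hk
  have h2 : k ≠ k₀ := fun h2 => h₀ (h2 ▸ hk)
  simp [weight, hk, h1, h2]

lemma sum_weight [NeZero c] (k₀ : ZMod c) : ∑ k, T.weight k₀ k = c + 1 := by
  classical
  unfold weight
  have hshift : ∑ k, (if T.Bad (k - 1) then 1 else 0) = ∑ k, if T.Bad k then 1 else 0 :=
    (Equiv.subRight (1 : ZMod c)).sum_comp (fun k => if T.Bad k then 1 else 0)
  rw [Finset.sum_add_distrib, Finset.sum_add_distrib, hshift, ← Finset.sum_add_distrib, Finset.sum_congr rfl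
      (g := fun _ => 1) (fun k _ => by split_ifs <;> rfl)]
  simp [ZMod.card]

lemma exists_pathOn_tip_forward (j : ZMod c) {m : ℕ} (h1 : 1 ≤ m) (hm : m < c) :
    ∃ n, PathOn H Set.univ (T.tip (j + (m : ℕ))) (T.tip j) n ∧ m + 1 ≤ n :=
  ⟨_, ((T.pathOn_ribbon j h1 hm le_rfl le_rfl).symm).mono (Set.subset_univ _), by omega⟩

lemma exists_pathOn_tip_backward (j : ZMod c) {m : ℕ} (h1 : 1 ≤ m) (hm : m < c) :
    ∃ n, PathOn H Set.univ (T.tip (j + (m : ℕ))) (T.tip j) n ∧ c - m + 1 ≤ n := by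
  have := T.pathOn_ribbon (j + (m : ℕ)) (m := c - m) (by omega) (by omega) le_rfl le_rfl
  rw [add_natCast_sub j hm.le] at this
  exact ⟨_, this.mono (Set.subset_univ _), by omega⟩

/-- A path through all but few ring vertices using a link of the vertex preceding `j`. -/
lemma exists_pathOn_tip_of_link (j : ZMod c) {m q : ℕ} (h1 : 1 ≤ m) (hmq : m < q) (hq : q + 2 ≤ c)
    (he : 1 ≤ T.e (j + (m : ℕ))) (h : H.Adj (T.y (j - 1) 0) (T.y (j + (m : ℕ)) 1)) :
    ∃ n, PathOn H Set.univ (T.tip (j + (q : ℕ))) (T.tip j) n ∧ m + 2 + (c - q) ≤ n := by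
  have e1 : j + (q : ZMod c) + ((c - 1 - q : ℕ) : ZMod c) = j - 1 := by
    have : ((q + (c - 1 - q) + 1 : ℕ) : ZMod c) = 0 := by
      rw [show q + (c - 1 - q) + 1 = c by omega, ZMod.natCast_self]
    push_cast at this
    linear_combination this
  have a1 := T.pathOn_ribbon j (s := T.e j) h1 (by omega) le_rfl he
  have a2 := (T.pathOn_ribbon (j + (q : ℕ)) (m := c - 1 - q) (s := T.e (j + (q : ℕ))) (t := 0)
    (by omega) (by omega) le_rfl (Nat.zero_le _)).symm
  rw [e1] at a2
  have := a1.trans h.symm a2 (T.disjoint_img (disjoint_of_fst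
    (cyclicArc_disjoint (p := j) hmq (m' := c - 1 - q) (by omega))
    (fun x hx => hx.1) (fun x hx => hx.1)))
  exact ⟨_, this.symm.mono (Set.subset_univ _), by omega⟩

/-- Bound for the weight of a set in terms of the last position it occupies. -/
lemma sum_weight_le [NeZero c] (hc : CircumferenceLE H c) (hT : T.Saturated) (k₀ : ZMod c)
    {j : ZMod c} (hj : ¬ T.Bad j) {A : Finset (ZMod c)} (hA : ∀ i ∈ A, ¬ T.Bad i) {m : ℕ}
    (hm : m < c) (hlast : ∀ r : ℕ, r < c → j + (r : ℕ) ∈ A → r ≤ m) (hbm : ¬ T.Bad (j + (m : ℕ))) :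
    ∑ i ∈ A, T.weight k₀ i ≤ m + 3 ∧
      (¬ T.Bad (j - 1) ∨
        (∃ r : ℕ, 1 ≤ r ∧ r ≤ m ∧ ¬ T.Bad (j + (r : ℕ)) ∧ j + (r : ℕ) ∉ A) →
        ∑ i ∈ A, T.weight k₀ i ≤ m + 2) := by
  classical
  have hsum : ∑ i ∈ A, T.weight k₀ i =
      ∑ r ∈ Finset.range m,
        (if j + ((r + 1 : ℕ) : ZMod c) ∈ A then T.weight k₀ (j + ((r + 1 : ℕ) : ZMod c)) else 0) +
      (if j ∈ A then T.weight k₀ j else 0) := by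
    rw [← Finset.univ_inter A, ← Finset.sum_ite_mem, Finset.univ_inter, sum_zmod_eq_sum_range j,
      ← Finset.sum_subset (Finset.range_mono (show m + 1 ≤ c by omega)), Finset.sum_range_succ']
    · simp
    · intro r hr hr'
      rw [Finset.mem_range] at hr hr'
      refine if_neg fun h => ?_
      have := hlast r hr h
      omega
  have hterm : ∀ r ∈ Finset.range m,
      (if j + ((r + 1 : ℕ) : ZMod c) ∈ A then T.weight k₀ (j + ((r + 1 : ℕ) : ZMod c)) else 0) ≤
      (if j + ((r + 1 : ℕ) : ZMod c) ∈ A then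
        1 + (if T.Bad (j + (r : ℕ)) then 1 else 0) else 0) +
      (if j + ((r + 1 : ℕ) : ZMod c) = k₀ then 1 else 0) := by
    intro r _
    by_cases h : j + ((r + 1 : ℕ) : ZMod c) ∈ A
    · rw [if_pos h, if_pos h, weight, if_neg (hA _ h),
        show j + ((r + 1 : ℕ) : ZMod c) - 1 = j + (r : ℕ) by push_cast; ring]
    · rw [if_neg h]
      exact Nat.zero_le _
  have hcount := sum_range_add_le (a := fun r => j + (r : ZMod c) ∈ A)
    (b := fun r => T.Bad (j + (r : ZMod c))) (by simpa using hj)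
    (fun r h => by
      have := h.not_bad_add_one hc hT
      rwa [add_assoc, ← Nat.cast_add_one] at this)
    (fun r h => hA _ h) m
  rw [if_neg hbm] at hcount
  have hdist : ∑ r ∈ Finset.range m, (if j + ((r + 1 : ℕ) : ZMod c) = k₀ then 1 else 0) ≤
      if j = k₀ then 0 else 1 := by
    split_ifs with h
    · refine (Finset.sum_eq_zero fun r hr => if_neg fun h' => ?_).le
      rw [Finset.mem_range] at hr
      have := add_natCast_zmod_inj (p := j) (a := r + 1) (b := 0) (by omega) (by omega)
        (by rw [h', ← h]; simp)
      omega
    · rw [← Finset.card_filter]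
      refine Finset.card_le_one.2 fun r hr s hs => ?_
      rw [Finset.mem_filter, Finset.mem_range] at hr hs
      have := add_natCast_zmod_inj (p := j) (a := r + 1) (b := s + 1) (by omega) (by omega)
        (hr.2.trans hs.2.symm)
      omega
  have hj' : (if j ∈ A then T.weight k₀ j else 0) ≤
      1 + (if T.Bad (j - 1) then 1 else 0) + (if j = k₀ then 1 else 0) := by
    by_cases h : j ∈ A
    · rw [if_pos h, weight, if_neg hj]
    · rw [if_neg h]
      exact Nat.zero_le _
  generalize (if j ∈ A then T.weight k₀ j else 0) = w at hsum hj'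
  have hle := Finset.sum_le_sum hterm
  rw [Finset.sum_add_distrib] at hle
  refine ⟨?_, ?_⟩
  · rw [hsum]
    split_ifs at hdist hj' <;> omega
  · rintro (h | ⟨r, h1, h2, h3, h4⟩)
    · rw [if_neg h] at hj'
      split_ifs at hdist hj' <;> omega
    · have : 1 ≤ ∑ r ∈ Finset.range m, (if ¬ T.Bad (j + ((r + 1 : ℕ) : ZMod c)) ∧
          j + ((r + 1 : ℕ) : ZMod c) ∉ A then 1 else 0) := by
        refine le_trans ?_ (Finset.single_le_sum (fun _ _ => Nat.zero_le _)
          (Finset.mem_range.2 (show r - 1 < m by omega)))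
        rw [Nat.sub_add_cancel h1, if_pos ⟨h3, h4⟩]
      split_ifs at hdist hj' <;> omega

end TailSystem

namespace TailSystem

variable {W : Type*} {H : SimpleGraph W} {c : ℕ} {T : TailSystem H c}

lemma weight_le_two {k₀ j : ZMod c} (h₀ : ¬ T.Bad (k₀ - 1)) (hj : ¬ T.Bad j) :
    T.weight k₀ j ≤ 2 := by
  unfold weight
  by_cases h : j = k₀
  · subst h
    rw [if_neg hj, if_neg h₀, if_pos rfl]
  · rw [if_neg hj, if_neg h]
    split_ifs <;> omega

/-- From the end of a tail that is not bad, a long path leads to some member of `A`. -/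
lemma exists_pathOn_tip_of_last [NeZero c] (hc : CircumferenceLE H c) (hT : T.Saturated)
    (k₀ : ZMod c) {j : ZMod c} (hj : ¬ T.Bad j) {A : Finset (ZMod c)}
    (hA : ∀ i ∈ A, ¬ T.Bad i) {m : ℕ} (h1 : 1 ≤ m) (hm : m < c) (hmA : j + (m : ℕ) ∈ A)
    (hlast : ∀ r : ℕ, r < c → j + (r : ℕ) ∈ A → r ≤ m) :
    ∃ i ∈ A, ∃ n, PathOn H Set.univ (T.tip i) (T.tip j) n ∧ ∑ i ∈ A, T.weight k₀ i ≤ n + 1 := by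
  have hbm := hA _ hmA
  obtain ⟨w3, w2⟩ := sum_weight_le hc hT k₀ hj hA hm hlast hbm
  by_cases hgap : ¬ T.Bad (j - 1) ∨
      ∃ r : ℕ, 1 ≤ r ∧ r ≤ m ∧ ¬ T.Bad (j + (r : ℕ)) ∧ j + (r : ℕ) ∉ A
  · obtain ⟨n, hn, hle⟩ := T.exists_pathOn_tip_forward j h1 hm
    have := w2 hgap
    exact ⟨_, hmA, n, hn, by omega⟩
  push Not at hgap
  obtain ⟨hbad, hfull⟩ := hgap
  have next : ∀ r : ℕ, r < m → ∃ q : ℕ, r < q ∧ q ≤ r + 2 ∧ q ≤ m ∧ j + (q : ℕ) ∈ A := by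
    intro r hr
    by_cases hb : T.Bad (j + ((r + 1 : ℕ) : ZMod c))
    · have hr1 : r + 1 ≠ m := fun h => hbm (h ▸ hb)
      have hb2 := hb.not_bad_add_one hc hT
      rw [add_assoc, ← Nat.cast_add_one] at hb2
      exact ⟨r + 2, by omega, by omega, by omega, hfull _ (by omega) (by omega) hb2⟩
    · exact ⟨r + 1, by omega, by omega, by omega, hfull _ (by omega) (by omega) hb⟩
  have hmc : m + 2 ≤ c := by
    by_contra! h
    have : ((m + 1 : ℕ) : ZMod c) = 0 := by
      rw [show m + 1 = c by omega, ZMod.natCast_self]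
    push_cast at this
    rw [eq_neg_of_add_eq_zero_left this, ← sub_eq_add_neg] at hbm
    exact hbm hbad
  by_cases hmc' : m + 2 = c
  · obtain ⟨k, hk⟩ := hbad.links_nonempty hT
    obtain ⟨q, hq1, hq2, rfl⟩ := exists_of_mem_links hc hk
    have e : j - 1 + (q : ZMod c) = j + ((q - 1 : ℕ) : ZMod c) := by
      rw [Nat.cast_pred (by omega)]; ring
    have hk2 := hk.2
    rw [e] at hk2
    have hlt : q - 1 < m := by
      by_contra! h
      omega
    obtain ⟨r, hr1, hr2, hr3, hr⟩ := next (q - 1) hlt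
    obtain ⟨n, hn, hle⟩ := T.exists_pathOn_tip_of_link j (by omega) hr1 (by omega) hk2.1 hk2.2
    exact ⟨_, hr, n, hn, by omega⟩
  · obtain ⟨q, hq1, hq2, hq3, hq⟩ := next 0 h1
    obtain ⟨n, hn, hle⟩ := T.exists_pathOn_tip_backward j hq1 (by omega)
    exact ⟨_, hq, n, hn, by omega⟩

lemma exists_pathOn_tip [NeZero c] (hc : CircumferenceLE H c) (hT : T.Saturated)
    {k₀ : ZMod c} (h₀ : ¬ T.Bad (k₀ - 1)) {j : ZMod c} (hj : ¬ T.Bad j) {A : Finset (ZMod c)}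
    (hne : A.Nonempty) (hA : ∀ i ∈ A, ¬ T.Bad i) :
    ∃ i ∈ A, ∃ n, PathOn H Set.univ (T.tip i) (T.tip j) n ∧ ∑ i ∈ A, T.weight k₀ i ≤ n + 1 := by
  classical
  have hpos : ∀ i ∈ A, ∃ r, r ∈ (Finset.range c).filter (fun r : ℕ => j + (r : ZMod c) ∈ A) ∧
      i = j + (r : ℕ) := fun i hi => by
    obtain ⟨r, hr, rfl⟩ := exists_eq_add_natCast j i
    exact ⟨r, Finset.mem_filter.2 ⟨Finset.mem_range.2 hr, hi⟩, rfl⟩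
  obtain ⟨i, hi⟩ := hne
  obtain ⟨r, hr, -⟩ := hpos i hi
  obtain ⟨m, hm, hmax⟩ := Finset.exists_max_image _ id ⟨r, hr⟩
  rw [Finset.mem_filter, Finset.mem_range] at hm
  rcases Nat.eq_zero_or_pos m with rfl | h1
  · have hAj : A = {j} := by
      rw [Nat.cast_zero, add_zero] at hm
      refine Finset.eq_singleton_iff_unique_mem.2 ⟨hm.2, fun i hi => ?_⟩
      obtain ⟨r, hr, rfl⟩ := hpos i hi
      have := hmax r hr
      simp only [id] at this
      rw [show r = 0 by omega, Nat.cast_zero, add_zero]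
    rw [hAj, Finset.sum_singleton]
    exact ⟨j, Finset.mem_singleton_self j, 1, PathOn.single (Set.mem_univ _),
      weight_le_two h₀ hj⟩
  · exact exists_pathOn_tip_of_last hc hT k₀ hj hA h1 hm.1 hm.2 fun r hr h =>
      hmax r (Finset.mem_filter.2 ⟨Finset.mem_range.2 hr, h⟩)

end TailSystem

/-- In a graph whose longest cycle has `c` vertices there are `c` vertices with weights such that
the vertices of nonzero weight have small degree, and any set of them can be joined to any of
them by a path that is long compared with the weight of the set. -/
theorem CircumferenceLE.exists_weight {W : Type*} [Fintype W] {H : SimpleGraph W} {c : ℕ}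
    [NeZero c] (hc : CircumferenceLE H c) {u : ZMod c → W} (hu : IsRing H u) :
    ∃ (ω : ZMod c → ℕ) (w : ZMod c → W),
      (∀ i, ω i ≠ 0 → (H.neighborSet (w i)).ncard + 1 ≤ c) ∧ ∑ i, ω i = c + 1 ∧
      ∀ (j : ZMod c) (A : Finset (ZMod c)), ω j ≠ 0 → A.Nonempty → (∀ i ∈ A, ω i ≠ 0) →
        ∃ i ∈ A, ∃ n, PathOn H Set.univ (w i) (w j) n ∧ ∑ i ∈ A, ω i ≤ n + 1 := by
  obtain ⟨T, k, hT, h1, h2⟩ := TailSystem.exists_saturated_not_bad hc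
    { e := fun _ => 0
      y := fun i _ => u i
      inj := fun i j s t hs ht h => ⟨hu.inj h, by omega⟩
      adj_tail := fun i s hs => by omega
      adj_ring := hu.adj }
  have hgood : ∀ i, T.weight k i ≠ 0 → ¬ T.Bad i := fun i =>
    TailSystem.not_bad_of_weight_ne_zero hc hT h2
  exact ⟨T.weight k, T.tip, fun i hi => TailSystem.ncard_tip_lt_of_not_bad hc hT (hgood i hi),
    TailSystem.sum_weight k, fun j A hj hne hA =>
      TailSystem.exists_pathOn_tip hc hT h1 (hgood j hj) hne fun i hi => hgood i (hA i hi)⟩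

/-- Vertices outside a longest cycle, with weights, that can be joined outside the cycle by long
paths have few neighbours on the cycle. -/
lemma IsRing.sum_mul_ncard_le {V : Type*} {G : SimpleGraph V} {n c : ℕ} [NeZero n] [NeZero c]
    {x : ZMod n → V} (hx : IsRing G x) (hn : CircumferenceLE G n) {U : Set V}
    (hU : ∀ p, x p ∉ U) {ω : ZMod c → ℕ} {w : ZMod c → U}
    (hω : ∀ (j : ZMod c) (A : Finset (ZMod c)), ω j ≠ 0 → A.Nonempty → (∀ i ∈ A, ω i ≠ 0) →
      ∃ i ∈ A, ∃ m, PathOn (G.induce U) Set.univ (w i) (w j) m ∧ ∑ i ∈ A, ω i ≤ m + 1) :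
    ∑ i, ω i * {p | G.Adj (x p) (w i)}.ncard ≤ n := by
  classical
  have hn0 : 0 < n := NeZero.pos n
  let M : ZMod n → Finset (ZMod c) :=
    fun p => Finset.univ.filter fun i => ω i ≠ 0 ∧ G.Adj (x p) (w i)
  have hM : ∀ p i, i ∈ M p ↔ ω i ≠ 0 ∧ G.Adj (x p) (w i) := fun p i => by simp [M]
  have gap : ∀ (p : ZMod n) (d : ℕ), 1 ≤ d → d ≤ n → (M p).Nonempty →
      (M (p + (d : ℕ))).Nonempty → ∑ i ∈ M p, ω i ≤ d := by
    rintro p d hd hdn hne ⟨j, hj⟩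
    obtain ⟨i, hi, m, hm, hle⟩ := hω j (M p) ((hM _ _).1 hj).1 hne fun i hi => ((hM _ _).1 hi).1
    have hpath := (hm.map (Embedding.induce U)).mono (T := U) (by
      rintro _ ⟨v, -, rfl⟩
      exact v.2)
    have harc := hx.pathOn (p + (d : ℕ)) (m := n - d) (by omega)
    rw [add_natCast_sub p hdn] at harc
    have := hn _ _ _ _ (hpath.trans ((hM _ _).1 hj).2.symm harc (by
      rw [Set.disjoint_right]
      rintro _ ⟨q, -, rfl⟩
      exact hU q)) ((hM _ _).1 hi).2
    omega
  have hne : ∀ p (k : ℕ), k < ∑ i ∈ M p, ω i → (M p).Nonempty := fun p k hk => by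
    rw [Finset.nonempty_iff_ne_empty]
    rintro h
    simp [h] at hk
  have hinj : Function.Injective
      fun y : (Σ p : ZMod n, Fin (∑ i ∈ M p, ω i)) => y.1 + ((y.2 : ℕ) : ZMod n) := by
    rintro ⟨p, k, hk⟩ ⟨p', k', hk'⟩ h
    simp only at h
    have h1 := hne p k hk
    have h2 := hne p' k' hk'
    by_cases hp : p' = p
    · subst hp
      have := gap p' n hn0 le_rfl h1 (by simpa using h1)
      have := add_natCast_zmod_inj (p := p') (a := k) (b := k') (by omega) (by omega) h
      subst this
      rfl
    · obtain ⟨d, hd, hdn, rfl⟩ := exists_eq_add_natCast_pos hp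
      have g1 := gap p d hd hdn.le h1 h2
      have g2 := gap _ (n - d) (by omega) (by omega) h2 (by rwa [add_natCast_sub p hdn.le])
      have := add_natCast_zmod_inj (p := p) (a := k) (b := d + k') (by omega) (by omega)
        (by rw [h]; push_cast; ring)
      omega
  have hcard := Fintype.card_le_of_injective _ hinj
  rw [Fintype.card_sigma, ZMod.card] at hcard
  simp only [Fintype.card_fin] at hcard
  refine le_trans (le_of_eq ?_) hcard
  simp only [M, Finset.sum_filter]
  rw [Finset.sum_comm]
  refine Finset.sum_congr rfl fun i _ => ?_
  rw [← Finset.sum_filter, Finset.sum_const, smul_eq_mul, mul_comm,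
    Set.ncard_eq_toFinset_card']
  rcases Nat.eq_zero_or_pos (ω i) with h | h
  · simp [h]
  · simp [h.ne']

lemma bddAbove_cbar {W : Type*} [Fintype W] (H : SimpleGraph W) :
    BddAbove {n : ℕ | (n = 1 ∧ Nonempty W) ∨ (n = 2 ∧ ∃ u v : W, H.Adj u v) ∨
      ∃ (v : W) (c : H.Walk v v), c.IsCycle ∧ c.length = n} := by
  refine ⟨Fintype.card W + 2, ?_⟩
  rintro n (⟨rfl, -⟩ | ⟨rfl, -⟩ | ⟨v, C, hC, rfl⟩)
  · omega
  · omega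
  · have h3 := hC.three_le_length
    have : NeZero C.length := ⟨by omega⟩
    have := Fintype.card_le_of_injective _ (isRing_getVert hC).1.inj
    rw [ZMod.card] at this
    omega

lemma circumferenceLE_cbar {W : Type*} [Fintype W] (H : SimpleGraph W) :
    CircumferenceLE H (cbar H) := by
  intro S a b n h hba
  have h1 := h.one_le
  refine le_trans ?_ (le_csSup (bddAbove_cbar H) (a := max n 2) ?_)
  · exact le_max_left _ _
  · rcases Nat.lt_or_ge n 3 with hn | hn
    · exact Or.inr (Or.inl ⟨by omega, b, a, hba⟩)
    · rw [max_eq_left (by omega)]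
      exact Or.inr (Or.inr (h.exists_isCycle hba hn))

lemma exists_isRing_cbar {W : Type*} [Fintype W] [Nonempty W] (H : SimpleGraph W) :
    1 ≤ cbar H ∧ ∃ u : ZMod (cbar H) → W, IsRing H u := by
  have hmem := Nat.sSup_mem (s := {n : ℕ | (n = 1 ∧ Nonempty W) ∨
    (n = 2 ∧ ∃ u v : W, H.Adj u v) ∨ ∃ (v : W) (c : H.Walk v v), c.IsCycle ∧ c.length = n})
    ⟨1, Or.inl ⟨rfl, inferInstance⟩⟩ (bddAbove_cbar H)
  change (cbar H = 1 ∧ _) ∨ (cbar H = 2 ∧ _) ∨ ∃ (v : W) (c : H.Walk v v),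
    c.IsCycle ∧ c.length = cbar H at hmem
  rcases hmem with ⟨h, ⟨a⟩⟩ | ⟨h, a, b, hab⟩ | ⟨v, C, hC, h⟩
  · rw [h]
    exact ⟨le_rfl, fun _ => a, fun i j _ => Subsingleton.elim (α := Fin 1) i j,
      fun h => absurd rfl h⟩
  · rw [h]
    refine ⟨by omega, fun i : Fin 2 => if i = 0 then a else b, fun i j => ?_, fun _ i => ?_⟩
    · change Fin 2 at i j
      fin_cases i <;> fin_cases j <;> simp [hab.ne, hab.ne'] <;> rfl
    · change Fin 2 at i
      fin_cases i
      · exact hab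
      · exact hab.symm
  · rw [← h]
    exact ⟨by have := hC.three_le_length; omega, _, (isRing_getVert hC).1⟩

/-- A lower bound for the length of a longest cycle in terms of the minimum degree and the length
of a longest cycle outside it. -/
theorem IsLongestCycle.le_length {V : Type*} [Fintype V] {G : SimpleGraph V}
    {v : V} {C : G.Walk v v} (hC : IsLongestCycle G C) {δ : ℕ}
    (hδ : ∀ v, δ ≤ (G.neighborSet v).ncard) :
    (cbar (G.induce {x : V | x ∉ C.support}) + 1) *
      (δ + 1 - cbar (G.induce {x : V | x ∉ C.support})) ≤ C.length := by
  classical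
  have h3 := hC.1.three_le_length
  have : NeZero C.length := ⟨by omega⟩
  obtain ⟨hx, hsurj⟩ := isRing_getVert hC.1
  set x : ZMod C.length → V := fun i => C.getVert i.val
  set U := {x : V | x ∉ C.support} with hU
  set H := G.induce U
  rcases isEmpty_or_nonempty U with hemp | hne
  · have h0 : cbar H = 0 := by
      refine (congrArg sSup (Set.eq_empty_of_forall_notMem ?_)).trans (csSup_empty.trans rfl)
      rintro n (⟨-, ⟨a⟩⟩ | ⟨-, a, -⟩ | ⟨a, -⟩) <;> exact hemp.false a
    have hcard : Fintype.card V ≤ C.length := by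
      have := Fintype.card_le_of_surjective x fun z => hsurj z (by
        by_contra hz
        exact hemp.false ⟨z, hz⟩)
      rwa [ZMod.card] at this
    have h1 := Set.ncard_le_ncard (Set.subset_univ (insert v (G.neighborSet v)))
    rw [Set.ncard_insert_of_notMem G.notMem_neighborSet_self, Set.ncard_univ,
      Nat.card_eq_fintype_card] at h1
    have := hδ v
    rw [h0]
    omega
  · obtain ⟨h1, u, hu⟩ := exists_isRing_cbar H
    have : NeZero (cbar H) := ⟨by omega⟩
    obtain ⟨ω, w, hdeg, hsum, hω⟩ := (circumferenceLE_cbar H).exists_weight hu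
    have hn : CircumferenceLE G C.length := fun S a b n h hba => by
      rcases Nat.lt_or_ge n 3 with hn | hn
      · omega
      · obtain ⟨z, D, hD, rfl⟩ := h.exists_isCycle hba hn
        exact hC.2 z D hD
    have hle := hx.sum_mul_ncard_le hn (U := U)
      (fun p hp => hp (C.getVert_mem_support _)) hω
    rw [← hsum, Finset.sum_mul]
    refine le_trans (Finset.sum_le_sum fun i _ => ?_) hle
    rcases Nat.eq_zero_or_pos (ω i) with h | h
    · simp [h]
    refine Nat.mul_le_mul_left _ ?_
    have hsub : G.neighborSet (w i) ⊆ Subtype.val '' H.neighborSet (w i) ∪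
        x '' {p | G.Adj (x p) (w i)} := by
      intro z hz
      by_cases hzU : z ∈ U
      · exact Or.inl ⟨⟨z, hzU⟩, hz, rfl⟩
      · obtain ⟨p, rfl⟩ := hsurj z (not_not.1 hzU)
        exact Or.inr ⟨p, G.adj_symm hz, rfl⟩
    have b1 := (Set.ncard_le_ncard hsub (Set.toFinite _)).trans (Set.ncard_union_le _ _)
    have b2 := Set.ncard_image_le (f := Subtype.val) (H.neighborSet (w i)).toFinite
    have b3 := Set.ncard_image_le (f := x) {p | G.Adj (x p) (w i)}.toFinite
    have := hdeg i h.ne'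
    have := hδ (w i)
    omega

/-- Theorem 6: if a longest cycle `C` satisfies
`min (l-1) (δ-l+1) ≤ c̄ ≤ max (l-1) (δ-l+1)`, then `|C| ≥ l(δ-l+2)`. -/
theorem stmt_5 {V : Type*} [Fintype V] [DecidableEq V] (G : SimpleGraph V)
    [DecidableRel G.Adj] (l : ℕ) (hl : 1 ≤ l)
    {v : V} (C : G.Walk v v) (hC : IsLongestCycle G C)
    (hlo : min ((l : ℤ) - 1) ((G.minDegree : ℤ) - (l : ℤ) + 1) ≤
      (cbar (G.induce {x : V | x ∉ C.support}) : ℤ))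
    (hhi : (cbar (G.induce {x : V | x ∉ C.support}) : ℤ) ≤
      max ((l : ℤ) - 1) ((G.minDegree : ℤ) - (l : ℤ) + 1)) :
    (C.length : ℤ) ≥ (l : ℤ) * ((G.minDegree : ℤ) - (l : ℤ) + 2) := by
  have hδ : ∀ z, G.minDegree ≤ (G.neighborSet z).ncard := fun z => by
    rw [Set.ncard_eq_toFinset_card', ← neighborFinset_def, card_neighborFinset_eq_degree]
    exact G.minDegree_le_degree z
  have hle := hC.le_length hδ
  generalize cbar (G.induce {x : V | x ∉ C.support}) = c at hle hlo hhi
  have h1 : ((c : ℤ) + 1) * ((G.minDegree : ℤ) + 1 - c) ≤ C.length := by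
    calc ((c : ℤ) + 1) * ((G.minDegree : ℤ) + 1 - c)
        ≤ ((c : ℤ) + 1) * ((G.minDegree + 1 - c : ℕ) : ℤ) :=
          mul_le_mul_of_nonneg_left (by omega) (by omega)
      _ ≤ C.length := by exact_mod_cast hle
  have h2 : 0 ≤ ((c : ℤ) - (l - 1)) * ((G.minDegree : ℤ) - l + 1 - c) := by
    rcases le_total ((l : ℤ) - 1) ((G.minDegree : ℤ) - l + 1) with h | h
    · rw [min_eq_left h] at hlo
      rw [max_eq_right h] at hhi
      exact mul_nonneg (by omega) (by omega)
    · rw [min_eq_right h] at hlo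
      rw [max_eq_left h] at hhi
      exact mul_nonneg_of_nonpos_of_nonpos (by omega) (by omega)
  linarith
end
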